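/- (Inner deformations) Let m be a formal n-parameter family of A∞-structures on V with parameters t_1,…,t_n of even degrees. Fix a cup polynomial Δ: for a degree-1 homogeneous ñ ∈ W[[t_1,…,t_n,t_0]], let Δ[ñ] = Σ_{l=1}^{L} Σ_{i_1,…,i_l ∈ {1,…,n}} c^{i_1⋯i_l} ñ_{(i_1)} ∪ ⋯ ∪ ñ_{(i_l)} (iterated from left to right), where ñ_{(i)} = ∂ñ/∂t_i, the cup product is formed with ñ itself (A∪B = (−1)^{|A|−1} ñ{A,B}), and the coefficients c^{i_1⋯i_l} ∈ k[[t_1,…,t_n]] are homogeneous and chosen so that Δ[ñ] is homogeneous of one fixed odd degree δ whenever ñ is homogeneous of degree 1. Let t_0 be a new formal variable of (even) degree 1 − δ. Then the differential equation ∂ñ/∂t_0 = Δ[ñ] with initial condition ñ|_{t_0=0} = m has a unique formal solution ñ ∈ W[[t_1,…,t_n,t_0]]; this solution is homogeneous of degree 1 and satisfies ñ∘ñ = 0, i.e. ñ is a formal (n+1)-parameter family of A∞-structures deforming m. -/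

import Mathlib

namespace Ainf

variable (k : Type*) [Field k] [CharZero k]
variable (V : ℤ → Type*) [∀ l, AddCommGroup (V l)] [∀ l, Module k (V l)]

/-- Homogeneous elements of `V`, tagged with their degree. -/
abbrev HV := Σ l : ℤ, V l

/-- Total degree of a list of homogeneous elements. -/
def degSum (vs : List (HV V)) : ℤ := (vs.map Sigma.fst).sum

/-- Cast between homogeneous components (junk value `0` if the degrees differ;
in all intended uses the degrees provably agree). -/
def vcast {a b : ℤ} (x : V a) : V b := if h : a = b then h ▸ x else 0

/-- A homogeneous degree-`d` element of `Hom(T(V),V)`, encoded by its values on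
tuples (lists) of homogeneous elements of `V`. -/
abbrev E (d : ℤ) := (vs : List (HV V)) → V (d + degSum V vs)

/-- Multilinearity (over `k`, in each slot) of a graded map: this singles out the
elements of `W = Hom(T(V),V)` among all functions on homogeneous tuples. -/
def IsMultilinear {d : ℤ} (f : E V d) : Prop :=
  (∀ (xs zs : List (HV V)) (l : ℤ) (x y : V l),
      (vcast V (f (xs ++ ⟨l, x + y⟩ :: zs)) : V (d + degSum V xs + l + degSum V zs)) =
        vcast V (f (xs ++ ⟨l, x⟩ :: zs)) + vcast V (f (xs ++ ⟨l, y⟩ :: zs))) ∧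
  (∀ (xs zs : List (HV V)) (l : ℤ) (c : k) (x : V l),
      (vcast V (f (xs ++ ⟨l, c • x⟩ :: zs)) : V (d + degSum V xs + l + degSum V zs)) =
        c • vcast V (f (xs ++ ⟨l, x⟩ :: zs)))

/-- All splittings of a list into two consecutive parts. -/
def splits2 {α : Type*} (vs : List α) : List (List α × List α) :=
  (List.range (vs.length + 1)).map fun i => (vs.take i, vs.drop i)

/-- All splittings of a list into three consecutive parts. -/
def splits3 {α : Type*} (vs : List α) : List (List α × List α × List α) :=
  (splits2 vs).flatMap fun p => (splits2 p.2).map fun q => (p.1, q.1, q.2)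

/-- The Gerstenhaber composition product
`(f∘g)(v₁,…) = Σᵢ (−1)^{|g|(|v₁|+⋯+|vᵢ|)} f(v₁,…,vᵢ,g(v_{i+1},…),…)`. -/
def gcomp {a b : ℤ} (f : E V a) (g : E V b) : E V (a + b) := fun vs =>
  ((splits3 vs).map fun p =>
    ((-1 : k) ^ (b * degSum V p.1)) •
      vcast V (f (p.1 ++ ⟨b + degSum V p.2.1, g p.2.1⟩ :: p.2.2))).sum

/-- Degree recast of a graded map (junk when the degrees differ). -/
def recast {a b : ℤ} (f : E V a) : E V b := fun vs => vcast V (f vs)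

/-- The Gerstenhaber bracket `[f,g] = f∘g − (−1)^{|f||g|} g∘f`. -/
def gbr {a b : ℤ} (f : E V a) (g : E V b) : E V (a + b) :=
  gcomp k V f g - ((-1 : k) ^ (a * b)) • recast V (gcomp k V g f)

/-- A homogeneous element of `W`, packaged with its degree. -/
abbrev GE := Σ d : ℤ, E V d

/-- Total degree of a list of homogeneous elements of `W`. -/
def degl (As : List (GE V)) : ℤ := (As.map Sigma.fst).sum

/-- Auxiliary enumeration of all ordered disjoint insertions of the operations `Bs`
into a tuple `vs`, together with the Koszul sign exponents
`ε = Σᵢ |Bᵢ|(|v₁|+⋯+|v_{kᵢ}|)`. -/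
def ins : List (GE V) → List (HV V) → List (ℤ × List (HV V))
  | [], vs => [(0, vs)]
  | B :: Bs, vs =>
    (splits3 vs).flatMap fun p =>
      (ins Bs p.2.2).map fun q =>
        (B.1 * degSum V p.1 + degl V Bs * (degSum V p.1 + degSum V p.2.1) + q.1,
          p.1 ++ ⟨B.1 + degSum V p.2.1, B.2 p.2.1⟩ :: q.2)

/-- The brace operations `A{A₁,…,Aₚ}`. -/
def braces {a : ℤ} (A : E V a) (As : List (GE V)) : E V (a + degl V As) := fun vs =>
  ((ins V As vs).map fun q => ((-1 : k) ^ q.1) • vcast V (A q.2)).sum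

section PowerSeries

variable (ι : Type*) [Fintype ι] [DecidableEq ι] (td : ι → ℤ)

/-- Multi-indices (exponents of the formal variables). -/
abbrev MI := ι → ℕ

/-- Total internal degree `Σᵢ αᵢ·|tᵢ|` of the monomial `t^α`. -/
def degM (α : MI ι) : ℤ := ∑ i, (α i : ℤ) * td i

/-- A homogeneous degree-`d` element of `W[[t₁,…]]`: the coefficient of `t^α` is a
homogeneous element of `W` of degree `d − deg t^α`. -/
abbrev PS (d : ℤ) := (α : MI ι) → E V (d - degM ι td α)

/-- The multi-indices `β ≤ α` (the possible left factors in a decomposition `α = β + γ`). -/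
def below (α : MI ι) : Finset (MI ι) :=
  Fintype.piFinset fun i => Finset.range (α i + 1)

/-- Coefficientwise degree recast on power series. -/
def precast {a b : ℤ} (F : PS V ι td a) : PS V ι td b := fun α => recast V (F α)

/-- The composition product on `W[[t]]`, extended coefficientwise (Cauchy product). -/
def pcomp {a b : ℤ} (F : PS V ι td a) (G : PS V ι td b) : PS V ι td (a + b) := fun α =>
  ∑ β ∈ below ι α, recast V (gcomp k V (F β) (G (α - β)))

/-- The Gerstenhaber bracket on `W[[t]]`. -/
def pbr {a b : ℤ} (F : PS V ι td a) (G : PS V ι td b) : PS V ι td (a + b) :=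
  pcomp k V ι td F G - ((-1 : k) ^ (a * b)) • precast V ι td (pcomp k V ι td G F)

/-- Formal partial derivative `∂F/∂tᵢ` of a power series. -/
def pderiv {d : ℤ} (F : PS V ι td d) (i : ι) : PS V ι td (d - td i) := fun α =>
  ((α i + 1 : ℕ) : k) • recast V (F (α + Pi.single i 1))

/-- The differential `M₁(A) = m∘A − (−1)^{|A|}A∘m` on `W[[t]]`. -/
def pM1 (m : PS V ι td 1) {a : ℤ} (A : PS V ι td a) : PS V ι td (a + 1) :=
  precast V ι td (pcomp k V ι td m A) -
    ((-1 : k) ^ a) • precast V ι td (pcomp k V ι td A m)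

/-- The binary brace `m{A,B}` on `W[[t]]`, extended coefficientwise. -/
def pbr2 (m : PS V ι td 1) {a b : ℤ} (A : PS V ι td a) (B : PS V ι td b) :
    PS V ι td (a + b + 1) := fun α =>
  ∑ β ∈ below ι α, ∑ γ ∈ below ι (α - β),
    recast V (braces k V (m β)
      [⟨a - degM ι td γ, A γ⟩, ⟨b - degM ι td (α - β - γ), B (α - β - γ)⟩])

/-- The cup product `A ∪ B = (−1)^{|A|−1} m{A,B}` on `W[[t]]`. -/
def pcup (m : PS V ι td 1) {a b : ℤ} (A : PS V ι td a) (B : PS V ι td b) :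
    PS V ι td (a + b + 1) :=
  ((-1 : k) ^ (a - 1)) • pbr2 k V ι td m A B

end PowerSeries

section CupPolynomial

variable (ι : Type*) [Fintype ι] [DecidableEq ι] (td : ι → ℤ)

/-- Left-to-right iterated cup product `m₍i₀₎ ∪ m₍i₁₎ ∪ ⋯ ∪ m₍i_l₎` of partial
derivatives of a family `m`, together with its degree. -/
def cupIter (m : PS V ι td 1) (i0 : ι) (rest : List ι) : Σ d : ℤ, PS V ι td d :=
  rest.foldl
    (fun acc i => ⟨acc.1 + (1 - td i) + 1, pcup k V ι td m acc.2 (pderiv k V ι td m i)⟩)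
    ⟨1 - td i0, pderiv k V ι td m i0⟩

/-- Cauchy product of a power series in `W[[t]]` with a scalar power series
`c ∈ k[[t]]`, recast to a prescribed target degree `e` (the recast is the identity
in all intended uses, where `c` is homogeneous of degree `e − deg A`). -/
def csmul (c : MI ι → k) {a : ℤ} (A : PS V ι td a) (e : ℤ) : PS V ι td e := fun α =>
  ∑ β ∈ below ι α, c β • recast V (A (α - β))

/-- Evaluation `Δ[m] = Σ c^{i₁⋯i_l}· m₍i₁₎ ∪ ⋯ ∪ m₍i_l₎` of a cup polynomial, given by a
finite list of terms `(c, i₁, [i₂,…,i_l])`, on a family `m`; the result is collected in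
degree `δ`. -/
def deltaEval (m : PS V ι td 1) (δ : ℤ) (ts : List ((MI ι → k) × ι × List ι)) :
    PS V ι td δ :=
  (ts.map fun t => csmul k V ι td t.1 (cupIter k V ι td m t.2.1 t.2.2).2 δ).sum

/-- Homogeneity of the coefficients of a cup polynomial: each scalar series
`c^{i₁⋯i_l}` is homogeneous of the degree making its term have total degree `δ`. -/
def CoeffHomog (m : PS V ι td 1) (δ : ℤ) (ts : List ((MI ι → k) × ι × List ι)) : Prop :=
  ∀ t ∈ ts, ∀ β : MI ι,
    degM ι td β ≠ δ - (cupIter k V ι td m t.2.1 t.2.2).1 → t.1 β = 0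

end CupPolynomial

section InnerDeformation

variable {n : ℕ} (td : Fin n → ℤ) (δ : ℤ)

/-- Degrees of the formal variables `t₀, t₁, …, tₙ`, where the new variable `t₀` has
degree `1 − δ`. -/
def tdx : Fin (n + 1) → ℤ := Fin.cons (1 - δ) td

/-- Lift of a scalar power series in `t₁,…,tₙ` to one in `t₀,t₁,…,tₙ`. -/
def liftC (c : (Fin n → ℕ) → k) : (Fin (n + 1) → ℕ) → k := fun β =>
  if β 0 = 0 then c (fun i => β i.succ) else 0

/-- Lift of a cup-polynomial term from `n` to `n+1` formal variables. -/
def liftTerm (t : ((Fin n → ℕ) → k) × Fin n × List (Fin n)) :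
    ((Fin (n + 1) → ℕ) → k) × Fin (n + 1) × List (Fin (n + 1)) :=
  (liftC k t.1, t.2.1.succ, t.2.2.map Fin.succ)

/-- `g ∈ W[[t₀,t₁,…,tₙ]]` solves the inner-deformation problem for the family `m` and
the cup polynomial `Δ` (given by the terms `ts`): the initial condition `g|_{t₀=0} = m`
and the differential equation `∂g/∂t₀ = Δ[g]` hold. -/
def IsSol (m : PS V (Fin n) td 1) (ts : List (((Fin n → ℕ) → k) × Fin n × List (Fin n)))
    (g : PS V (Fin (n + 1)) (tdx td δ) 1) : Prop :=
  (∀ α : Fin n → ℕ, g (Fin.cons 0 α) = recast V (m α)) ∧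
  pderiv k V (Fin (n + 1)) (tdx td δ) g 0 =
    precast V (Fin (n + 1)) (tdx td δ)
      (deltaEval k V (Fin (n + 1)) (tdx td δ) g δ (ts.map (liftTerm k)))

end InnerDeformation

section Deconcatenation

variable {H M : Type*} [AddCommGroup M]

/-- Sum of `φ p q` over all factorizations `vs = p ++ q`. -/
def splitSum (φ : List H → List H → M) (vs : List H) : M :=
  ((splits2 vs).map fun p => φ p.1 p.2).sum

/-- Sum of `φ` over all factorizations of a list into three consecutive parts. -/
def splitSum3 (φ : List H → List H → List H → M) (vs : List H) : M :=
  splitSum (fun a v => splitSum (fun b c => φ a b c) v) vs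

/-- Sum of `φ` over all factorizations of a list into five consecutive parts. -/
def splitSum5 (φ : List H → List H → List H → List H → List H → M) (vs : List H) : M :=
  splitSum (fun a v => splitSum (fun b v => splitSum (fun c v =>
    splitSum (fun d e => φ a b c d e) v) v) v) vs

/-- Sum of `φ` over all factorizations of a list into seven consecutive parts. -/
def splitSum7 (φ : List H → List H → List H → List H → List H → List H → List H → M)
    (vs : List H) : M :=
  splitSum (fun a v => splitSum (fun b v => splitSum (fun c v => splitSum (fun d v =>
    splitSum (fun e v => splitSum (fun f g => φ a b c d e f g) v) v) v) v) v) vs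

@[simp] lemma splitSum_nil (φ : List H → List H → M) : splitSum φ [] = φ [] [] := by
  simp [splitSum, splits2]

lemma splitSum_cons (φ : List H → List H → M) (v : H) (vs : List H) :
    splitSum φ (v :: vs) = φ [] (v :: vs) + splitSum (fun p => φ (v :: p)) vs := by
  simp [splitSum, splits2, List.range_succ_eq_map, Function.comp_def]

lemma splitSum_add (φ ψ : List H → List H → M) (vs : List H) :
    splitSum (fun p q => φ p q + ψ p q) vs = splitSum φ vs + splitSum ψ vs := by
  simp [splitSum, List.sum_map_add]

lemma map_splitSum {N F : Type*} [AddCommGroup N] [FunLike F M N] [AddMonoidHomClass F M N]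
    (f : F) (φ : List H → List H → M) (vs : List H) :
    f (splitSum φ vs) = splitSum (fun p q => f (φ p q)) vs := by
  simp [splitSum, map_list_sum, Function.comp_def]

@[simp] lemma splitSum_zero (vs : List H) : splitSum (fun _ _ => (0 : M)) vs = 0 := by
  simp [splitSum]

lemma splitSum_neg (φ : List H → List H → M) (vs : List H) :
    splitSum (fun p q => - φ p q) vs = - splitSum φ vs :=
  (map_splitSum (negAddMonoidHom (α := M)) φ vs).symm

lemma splitSum_smul {R : Type*} [Ring R] [Module R M] (c : R) (φ : List H → List H → M)
    (vs : List H) : c • splitSum φ vs = splitSum (fun p q => c • φ p q) vs :=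
  map_splitSum (DistribSMul.toAddMonoidHom M c) φ vs

/-- Factorizations of a list with a marked letter, according to the part containing it. -/
lemma splitSum_insert (φ : List H → List H → M) (x : List H) (a : H) (z : List H) :
    splitSum φ (x ++ a :: z) =
      splitSum (fun p q => φ p (q ++ a :: z)) x + splitSum (fun p q => φ (x ++ a :: p) q) z := by
  induction x generalizing φ with
  | nil => simp [splitSum_cons]
  | cons v x ih => simp [splitSum_cons, ih, add_assoc]

lemma splitSum_assoc (φ : List H → List H → List H → M) (vs : List H) :
    splitSum (fun w z => splitSum (fun x y => φ x y z) w) vs =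
      splitSum (fun x w => splitSum (fun y z => φ x y z) w) vs := by
  induction vs generalizing φ with
  | nil => simp
  | cons v vs ih => simp [splitSum_cons, splitSum_add, ih, add_assoc]

lemma splitSum_comm (xs : List H) (ψ : List H → List H → List H → List H → M) (ys : List H) :
    splitSum (fun a b => splitSum (fun c d => ψ a b c d) xs) ys =
      splitSum (fun c d => splitSum (fun a b => ψ a b c d) ys) xs := by
  induction ys generalizing ψ with
  | nil => simp
  | cons v vs ih => simp [splitSum_cons, splitSum_add, ih]

lemma splitSum3_insert (φ : List H → List H → List H → M) (x : List H) (a : H) (z : List H) :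
    splitSum3 φ (x ++ a :: z) =
      splitSum3 (fun p q r => φ p q (r ++ a :: z)) x +
      splitSum (fun p q => splitSum (fun r s => φ p (q ++ a :: r) s) z) x +
      splitSum3 (fun p q r => φ (x ++ a :: p) q r) z := by
  simp only [splitSum3, splitSum_insert, splitSum_add, add_assoc]

lemma splitSum5_insert (φ : List H → List H → List H → List H → List H → M)
    (x : List H) (h : H) (z : List H) :
    splitSum5 φ (x ++ h :: z) =
      splitSum5 (fun a b c d e => φ (x ++ h :: a) b c d e) z +
      splitSum (fun a b => splitSum (fun b' v => splitSum (fun c v => splitSum (fun d e =>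
        φ a (b ++ h :: b') c d e) v) v) z) x +
      splitSum3 (fun a b c => splitSum (fun c' v => splitSum (fun d e =>
        φ a b (c ++ h :: c') d e) v) z) x +
      splitSum (fun a v => splitSum (fun b v => splitSum (fun c d => splitSum (fun d' e =>
        φ a b c (d ++ h :: d') e) z) v) v) x +
      splitSum5 (fun a b c d e => φ a b c d (e ++ h :: z)) x := by
  simp only [splitSum3, splitSum5, splitSum_insert, splitSum_add]
  abel

section Refine

variable (ψ : List H → List H → List H → List H → List H → List H → List H → M) (vs : List H)

lemma splitSum5_refine_first :
    splitSum5 (fun x y z u w => splitSum3 (fun p q r => ψ p q r y z u w) x) vs =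
      splitSum7 ψ vs := by
  have (x v : List H) : splitSum (fun y v => splitSum (fun z v => splitSum (fun u w =>
      splitSum (fun p v => splitSum (fun q r => ψ p q r y z u w) v) x) v) v) v =
      splitSum (fun p x => splitSum (fun q r => splitSum (fun y v => splitSum (fun z v =>
        splitSum (fun u w => ψ p q r y z u w) v) v) v) x) x := by
    simp only [splitSum_comm x]
    congr! 3 with p x'
    simp only [splitSum_comm x']
  simp only [splitSum3, splitSum5, splitSum7, this, splitSum_assoc]

lemma splitSum5_refine_second :
    splitSum5 (fun x y z u w => splitSum3 (fun p q r => ψ x p q r z u w) y) vs =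
      splitSum7 ψ vs := by
  have (x y v : List H) : splitSum (fun z v => splitSum (fun u w =>
      splitSum (fun p v => splitSum (fun q r => ψ x p q r z u w) v) y) v) v =
      splitSum (fun p y => splitSum (fun q r => splitSum (fun z v =>
        splitSum (fun u w => ψ x p q r z u w) v) v) y) y := by
    simp only [splitSum_comm y]
    congr! 3 with p y'
    simp only [splitSum_comm y']
  simp only [splitSum3, splitSum5, splitSum7, this, splitSum_assoc]

lemma splitSum5_refine_third :
    splitSum5 (fun x y z u w => splitSum3 (fun p q r => ψ x y p q r u w) z) vs =
      splitSum7 ψ vs := by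
  have (x y z v : List H) : splitSum (fun u w =>
      splitSum (fun p v => splitSum (fun q r => ψ x y p q r u w) v) z) v =
      splitSum (fun p z => splitSum (fun q r =>
        splitSum (fun u w => ψ x y p q r u w) v) z) z := by
    simp only [splitSum_comm z]
    congr! 3 with p z'
    simp only [splitSum_comm z']
  simp only [splitSum3, splitSum5, splitSum7, this, splitSum_assoc]

lemma splitSum5_refine_fourth :
    splitSum5 (fun x y z u w => splitSum3 (fun p q r => ψ x y z p q r w) u) vs =
      splitSum7 ψ vs := by
  simp only [splitSum3, splitSum5, splitSum7, splitSum_assoc]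

lemma splitSum5_refine_fifth :
    splitSum5 (fun x y z u w => splitSum3 (fun p q r => ψ x y z u p q r) w) vs =
      splitSum7 ψ vs := rfl

lemma splitSum5_refine_first_third :
    splitSum5 (fun x y z u w => splitSum (fun p q => splitSum (fun r s =>
      ψ p q y r s u w) z) x) vs = splitSum7 ψ vs := by
  have (x v : List H) : splitSum (fun y v => splitSum (fun z v => splitSum (fun u w =>
      splitSum (fun p q => splitSum (fun r s => ψ p q y r s u w) z) x) v) v) v =
      splitSum (fun p q => splitSum (fun y v => splitSum (fun r v => splitSum (fun s v =>
        splitSum (fun u w => ψ p q y r s u w) v) v) v) v) x := by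
    simp only [splitSum_comm x]
    congr! 3 with p q
    congr! 3 with y v
    have (z v : List H) : splitSum (fun u w => splitSum (fun r s => ψ p q y r s u w) z) v =
        splitSum (fun r s => splitSum (fun u w => ψ p q y r s u w) v) z := splitSum_comm z _ v
    simp only [this, splitSum_assoc]
  simp only [splitSum5, splitSum7, this, splitSum_assoc]

lemma splitSum5_refine_first_fifth :
    splitSum5 (fun x y z u w => splitSum (fun p q => splitSum (fun r s =>
      ψ p q y z u r s) w) x) vs = splitSum7 ψ vs := by
  have (x v : List H) : splitSum (fun y v => splitSum (fun z v => splitSum (fun u w =>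
      splitSum (fun p q => splitSum (fun r s => ψ p q y z u r s) w) x) v) v) v =
      splitSum (fun p q => splitSum (fun y v => splitSum (fun z v => splitSum (fun u v =>
        splitSum (fun r s => ψ p q y z u r s) v) v) v) v) x := by
    simp only [splitSum_comm x]
  simp only [splitSum5, splitSum7, this, splitSum_assoc]

lemma splitSum5_refine_third_fifth :
    splitSum5 (fun x y z u w => splitSum (fun p q => splitSum (fun r s =>
      ψ x y p q u r s) w) z) vs = splitSum7 ψ vs := by
  have (x y z v : List H) : splitSum (fun u w =>
      splitSum (fun p q => splitSum (fun r s => ψ x y p q u r s) w) z) v =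
      splitSum (fun p q => splitSum (fun u v =>
        splitSum (fun r s => ψ x y p q u r s) v) v) z := by
    simp only [splitSum_comm z]
  simp only [splitSum5, splitSum7, this, splitSum_assoc]

lemma splitSum3_refine_five_second :
    splitSum3 (fun x y z => splitSum5 (fun p q r s t => ψ x p q r s t z) y) vs =
      splitSum7 ψ vs := by
  simp only [splitSum3, splitSum5, splitSum7, splitSum_assoc]

lemma splitSum3_refine_five_last :
    splitSum3 (fun x y z => splitSum5 (fun a b c d e => ψ x y a b c d e) z) vs =
      splitSum7 ψ vs := rfl

lemma splitSum3_refine_five_first :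
    splitSum3 (fun x y z => splitSum5 (fun a b c d e => ψ a b c d e y z) x) vs =
      splitSum7 ψ vs := by
  have (x v : List H) : splitSum (fun y z => splitSum5 (fun a b c d e => ψ a b c d e y z) x) v =
      splitSum5 (fun a b c d e => splitSum (fun y z => ψ a b c d e y z) v) x := by
    simp only [splitSum5, splitSum_comm x]
    congr! 3 with a x
    simp only [splitSum_comm x]
    congr! 3 with b x
    simp only [splitSum_comm x]
    congr! 3 with c x
    simp only [splitSum_comm x]
  simp only [splitSum3, this]
  simp only [splitSum5, splitSum7, splitSum_assoc]

lemma splitSum3_refine_two_four :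
    splitSum3 (fun x y z => splitSum (fun a b => splitSum (fun b' v => splitSum (fun c v =>
      splitSum (fun d e => ψ a b y b' c d e) v) v) z) x) vs = splitSum7 ψ vs := by
  have (x v : List H) : splitSum (fun y z => splitSum (fun a b => splitSum (fun b' v =>
      splitSum (fun c v => splitSum (fun d e => ψ a b y b' c d e) v) v) z) x) v =
      splitSum (fun a b => splitSum (fun y z => splitSum (fun b' v =>
      splitSum (fun c v => splitSum (fun d e => ψ a b y b' c d e) v) v) z) v) x := by
    simp only [splitSum_comm x]
  simp only [splitSum3, splitSum7, this, splitSum_assoc]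

lemma splitSum3_refine_three_three :
    splitSum3 (fun x y z => splitSum3 (fun a b c => splitSum (fun c' v =>
      splitSum (fun d e => ψ a b c y c' d e) v) z) x) vs = splitSum7 ψ vs := by
  have (x v : List H) : splitSum (fun y z => splitSum (fun a v => splitSum (fun b c =>
      splitSum (fun c' v => splitSum (fun d e => ψ a b c y c' d e) v) z) v) x) v =
      splitSum (fun a v' => splitSum (fun b c => splitSum (fun y z =>
      splitSum (fun c' v => splitSum (fun d e => ψ a b c y c' d e) v) z) v) v') x := by
    simp only [splitSum_comm x]
    congr! 3 with a x
    simp only [splitSum_comm x]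
  simp only [splitSum3, splitSum7, this, splitSum_assoc]

lemma splitSum3_refine_four_two :
    splitSum3 (fun x y z => splitSum (fun a v => splitSum (fun b v => splitSum (fun c d =>
      splitSum (fun d' e => ψ a b c d y d' e) z) v) v) x) vs = splitSum7 ψ vs := by
  have (x v : List H) : splitSum (fun y z => splitSum (fun a v => splitSum (fun b v =>
      splitSum (fun c d => splitSum (fun d' e => ψ a b c d y d' e) z) v) v) x) v =
      splitSum (fun a v' => splitSum (fun b v' => splitSum (fun c d => splitSum (fun y z =>
      splitSum (fun d' e => ψ a b c d y d' e) z) v) v') v') x := by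
    simp only [splitSum_comm x]
    congr! 3 with a x
    simp only [splitSum_comm x]
    congr! 3 with b x
    simp only [splitSum_comm x]
  simp only [splitSum3, splitSum7, this, splitSum_assoc]

end Refine

end Deconcatenation

section Insertion

variable {k : Type*} [Field k] {H M : Type*} [AddCommGroup M] [Module k M]

/-- Signed insertion of an odd operation `g` into `F`. -/
def insOne (sgn : List H → k) (F : List H → M) (g : List H → H) (vs : List H) : M :=
  splitSum3 (fun x y z => sgn x • F (x ++ g y :: z)) vs

/-- Signed ordered insertion of two odd operations `A`, `B` into `F`. -/
def insTwo (sgn : List H → k) (F : List H → M) (A B : List H → H) (vs : List H) : M :=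
  splitSum5 (fun x y z u w => (sgn y * sgn z) • F (x ++ A y :: (z ++ B u :: w))) vs

lemma splitSum3_add (φ ψ : List H → List H → List H → M) (vs : List H) :
    splitSum3 (fun x y z => φ x y z + ψ x y z) vs = splitSum3 φ vs + splitSum3 ψ vs := by
  simp only [splitSum3, splitSum_add]

lemma splitSum5_add (φ ψ : List H → List H → List H → List H → List H → M) (vs : List H) :
    splitSum5 (fun x y z u w => φ x y z u w + ψ x y z u w) vs =
      splitSum5 φ vs + splitSum5 ψ vs := by
  simp only [splitSum5, splitSum_add]

lemma splitSum3_smul (c : k) (φ : List H → List H → List H → M) (vs : List H) :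
    c • splitSum3 φ vs = splitSum3 (fun x y z => c • φ x y z) vs := by
  simp only [splitSum3, splitSum_smul]

lemma splitSum5_smul (c : k) (φ : List H → List H → List H → List H → List H → M)
    (vs : List H) :
    c • splitSum5 φ vs = splitSum5 (fun x y z u w => c • φ x y z u w) vs := by
  simp only [splitSum5, splitSum_smul]

lemma splitSum7_neg (φ : List H → List H → List H → List H → List H → List H → List H → M)
    (vs : List H) :
    splitSum7 (fun a b c d e f g => - φ a b c d e f g) vs = - splitSum7 φ vs := by
  simp only [splitSum7, splitSum_neg]

lemma append_of_mem_splits2 {vs : List H} {p : List H × List H} (hp : p ∈ splits2 vs) :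
    p.1 ++ p.2 = vs := by
  simp only [splits2, List.mem_map] at hp
  obtain ⟨i, -, rfl⟩ := hp
  exact List.take_append_drop i vs

lemma splitSum_congr {φ ψ : List H → List H → M} {vs : List H}
    (h : ∀ p q, p ++ q = vs → φ p q = ψ p q) : splitSum φ vs = splitSum ψ vs := by
  unfold splitSum
  congr 1
  exact List.map_congr_left fun p hp => h _ _ (append_of_mem_splits2 hp)

lemma splitSum3_congr {φ ψ : List H → List H → List H → M} {vs : List H}
    (h : ∀ p q r, p ++ (q ++ r) = vs → φ p q r = ψ p q r) :
    splitSum3 φ vs = splitSum3 ψ vs :=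
  splitSum_congr fun p _ hp => splitSum_congr fun q r hq => h p q r (by rw [hq, hp])

lemma splitSum5_congr {φ ψ : List H → List H → List H → List H → List H → M} {vs : List H}
    (h : ∀ a b c d e, a ++ (b ++ (c ++ (d ++ e))) = vs → φ a b c d e = ψ a b c d e) :
    splitSum5 φ vs = splitSum5 ψ vs :=
  splitSum_congr fun a _ ha => splitSum_congr fun b _ hb => splitSum_congr fun c _ hc =>
    splitSum_congr fun d e hd => h a b c d e (by rw [hd, hc, hb, ha])

/-- The brace relation `F{g}{A,B} = F{A,B}{g} + F{g{A,B}} + F{[g,A],B} - F{A,[g,B]}` for odd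
operations, with all insertions of composites written out as sums. -/
theorem insTwo_insOne (sgn : List H → k) (happ : ∀ x y, sgn (x ++ y) = sgn x * sgn y)
    (hsq : ∀ x, sgn x * sgn x = 1)
    (F : List H → M) (g A B : List H → H)
    (hg : ∀ y, sgn [g y] = -sgn y) (hA : ∀ y, sgn [A y] = -sgn y)
    (hB : ∀ y, sgn [B y] = -sgn y) (vs : List H) :
    insTwo sgn (insOne sgn F g) A B vs =
      insOne sgn (insTwo sgn F A B) g vs +
      splitSum3 (fun x y z => sgn x • splitSum5 (fun p q r s t => (sgn q * sgn r) •
        F (x ++ g (p ++ A q :: (r ++ B s :: t)) :: z)) y) vs +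
      splitSum5 (fun x y z u w => (sgn x * sgn y * sgn z) •
        (splitSum3 (fun p q r => sgn p • F (x ++ g (p ++ A q :: r) :: (z ++ B u :: w))) y +
         splitSum3 (fun p q r => sgn p • F (x ++ A (p ++ g q :: r) :: (z ++ B u :: w))) y)) vs -
      splitSum5 (fun x y z u w => sgn x •
        (splitSum3 (fun p q r => sgn p • F (x ++ A y :: (z ++ g (p ++ B q :: r) :: w))) u +
         splitSum3 (fun p q r => sgn p • F (x ++ A y :: (z ++ B (p ++ g q :: r) :: w))) u)) vs := by
  have hcons (a : H) (x : List H) : sgn (a :: x) = sgn [a] * sgn x := by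
    rw [← happ]; rfl
  have hA' (y x : List H) : sgn (A y :: x) = -(sgn y * sgn x) := by rw [hcons, hA]; ring
  have hB' (y x : List H) : sgn (B y :: x) = -(sgn y * sgn x) := by rw [hcons, hB]; ring
  have hg' (y x : List H) : sgn (g y :: x) = -(sgn y * sgn x) := by rw [hcons, hg]; ring
  have e1 : insTwo sgn (insOne sgn F g) A B vs =
      splitSum7 (fun p q r y z u w => (sgn y * sgn z * sgn p) •
        F (p ++ g q :: (r ++ A y :: (z ++ B u :: w)))) vs +
      splitSum7 (fun p q y r s u w => (sgn p * sgn y * sgn r * sgn s) •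
        F (p ++ g (q ++ A y :: r) :: (s ++ B u :: w))) vs +
      splitSum7 (fun p q y z u r s => (sgn p * sgn y * sgn z) •
        F (p ++ g (q ++ A y :: (z ++ B u :: r)) :: s)) vs -
      splitSum7 (fun x y p q r u w => (sgn x * sgn q * sgn r) •
        F (x ++ A y :: (p ++ g q :: (r ++ B u :: w)))) vs -
      splitSum7 (fun x y p q u r s => (sgn x * sgn q) •
        F (x ++ A y :: (p ++ g (q ++ B u :: r) :: s))) vs +
      splitSum7 (fun x y z u p q r => (sgn x * sgn u * sgn p) •
        F (x ++ A y :: (z ++ B u :: (p ++ g q :: r)))) vs := by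
    simp only [sub_eq_add_neg, ← splitSum7_neg]
    rw [← splitSum5_refine_first, ← splitSum5_refine_first_third, ← splitSum5_refine_first_fifth,
      ← splitSum5_refine_third, ← splitSum5_refine_third_fifth, ← splitSum5_refine_fifth]
    simp only [← splitSum5_add]
    unfold insTwo
    congr! 1
    funext x y z u w
    simp only [insOne, splitSum3_insert, splitSum_insert, splitSum_add, smul_add, splitSum3_smul,
      splitSum_smul, smul_smul, happ, hA', hB', List.append_assoc, List.cons_append]
    simp only [add_assoc, ← neg_smul]
    congr! 1
    · congr! 1
      · exact splitSum_congr fun p q hx => splitSum_congr fun r s hz => by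
          rw [← hz, happ]; congr 1; ring
      congr! 1
      · exact splitSum_congr fun p q hx => splitSum_congr fun r s hw => by
          congr 1; ring
      congr! 1
      · exact splitSum3_congr fun p q r hz => by
          rw [← hz, happ, happ]; congr 1
          linear_combination -(sgn x * sgn q * sgn r) *
            (sgn p * sgn p * hsq y + hsq p)
      congr! 1
      · exact splitSum_congr fun p q hz => splitSum_congr fun r s hw => by
          rw [← hz, happ]; congr 1
          linear_combination -(sgn x * sgn q) * (sgn p * sgn p * hsq y + hsq p)
      · exact splitSum3_congr fun p q r hw => by
          congr 1
          linear_combination (sgn x * sgn u * sgn p) * (sgn z * sgn z * hsq y + hsq z)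
  have e2 : insOne sgn (insTwo sgn F A B) g vs =
      splitSum7 (fun p q r y z u w => (sgn y * sgn z * sgn p) •
        F (p ++ g q :: (r ++ A y :: (z ++ B u :: w)))) vs -
      splitSum7 (fun x p q r z u w => (sgn x * sgn q * sgn r * sgn z) •
        F (x ++ A (p ++ g q :: r) :: (z ++ B u :: w))) vs -
      splitSum7 (fun x y p q r u w => (sgn x * sgn q * sgn r) •
        F (x ++ A y :: (p ++ g q :: (r ++ B u :: w)))) vs +
      splitSum7 (fun x y z p q r w => (sgn x * sgn p) •
        F (x ++ A y :: (z ++ B (p ++ g q :: r) :: w))) vs +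
      splitSum7 (fun x y z u p q r => (sgn x * sgn u * sgn p) •
        F (x ++ A y :: (z ++ B u :: (p ++ g q :: r)))) vs := by
    simp only [sub_eq_add_neg, ← splitSum7_neg]
    rw [← splitSum3_refine_five_last, ← splitSum3_refine_two_four,
      ← splitSum3_refine_three_three, ← splitSum3_refine_four_two, ← splitSum3_refine_five_first]
    simp only [← splitSum3_add]
    refine splitSum3_congr fun x y z _ => ?_
    simp only [insTwo, splitSum5_insert, smul_add, splitSum3_smul, splitSum5_smul,
      splitSum_smul, smul_smul, happ, hg', List.append_assoc, List.cons_append, add_assoc,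
      ← neg_smul]
    congr! 1
    · exact splitSum5_congr fun a b c d e h => by congr 1; ring
    congr! 1
    · exact splitSum_congr fun a b h => splitSum_congr fun c v h' => splitSum_congr fun d v h'' =>
        splitSum_congr fun e f h''' => by
        rw [← h, happ]; congr 1
        linear_combination -(sgn a * sgn y * sgn c * sgn d) * hsq b
    congr! 1
    · exact splitSum3_congr fun a b c h => splitSum_congr fun c' v h' =>
        splitSum_congr fun d e h'' => by
        rw [← h, happ, happ]; congr 1
        linear_combination -(sgn a * sgn y * sgn c') * (sgn c * sgn c * hsq b + hsq c)
    congr! 1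
    · exact splitSum_congr fun a v h => splitSum_congr fun b v' h' =>
        splitSum_congr fun c d h'' => splitSum_congr fun d' e h''' => by
        rw [← h, ← h', ← h'', happ, happ, happ]; congr 1
        linear_combination (sgn a * sgn d) * (sgn c * sgn c * hsq b + hsq c)
    · exact splitSum5_congr fun a b c d e h => by
        rw [← h]; simp only [happ]; congr 1
        linear_combination (sgn a * sgn d * sgn e) * (sgn c * sgn c * hsq b + hsq c)
  have e3 : splitSum3 (fun x y z => sgn x • splitSum5 (fun p q r s t => (sgn q * sgn r) •
        F (x ++ g (p ++ A q :: (r ++ B s :: t)) :: z)) y) vs =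
      splitSum7 (fun p q y z u r s => (sgn p * sgn y * sgn z) •
        F (p ++ g (q ++ A y :: (z ++ B u :: r)) :: s)) vs := by
    simp only [splitSum5_smul, smul_smul, ← mul_assoc, ← splitSum3_refine_five_second]
  have e4 : splitSum5 (fun x y z u w => (sgn x * sgn y * sgn z) •
        (splitSum3 (fun p q r => sgn p • F (x ++ g (p ++ A q :: r) :: (z ++ B u :: w))) y +
         splitSum3 (fun p q r => sgn p • F (x ++ A (p ++ g q :: r) :: (z ++ B u :: w))) y)) vs =
      splitSum7 (fun p q y r s u w => (sgn p * sgn y * sgn r * sgn s) •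
        F (p ++ g (q ++ A y :: r) :: (s ++ B u :: w))) vs +
      splitSum7 (fun x p q r z u w => (sgn x * sgn q * sgn r * sgn z) •
        F (x ++ A (p ++ g q :: r) :: (z ++ B u :: w))) vs := by
    rw [← splitSum5_refine_second, ← splitSum5_refine_second, ← splitSum5_add]
    refine splitSum5_congr fun x y z u w _ => ?_
    simp only [smul_add, splitSum3_smul, smul_smul]
    congr! 1 <;> exact splitSum3_congr fun p q r h => by
      rw [← h, happ, happ]; congr 1
      linear_combination (sgn x * sgn q * sgn r * sgn z) * hsq p
  have e5 : splitSum5 (fun x y z u w => sgn x •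
        (splitSum3 (fun p q r => sgn p • F (x ++ A y :: (z ++ g (p ++ B q :: r) :: w))) u +
         splitSum3 (fun p q r => sgn p • F (x ++ A y :: (z ++ B (p ++ g q :: r) :: w))) u)) vs =
      splitSum7 (fun x y p q u r s => (sgn x * sgn q) •
        F (x ++ A y :: (p ++ g (q ++ B u :: r) :: s))) vs +
      splitSum7 (fun x y z p q r w => (sgn x * sgn p) •
        F (x ++ A y :: (z ++ B (p ++ g q :: r) :: w))) vs := by
    rw [← splitSum5_refine_fourth, ← splitSum5_refine_fourth, ← splitSum5_add]
    simp only [smul_add, splitSum3_smul, smul_smul]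
  rw [e1, e2, e3, e4, e5]
  abel

/-- `insOne` as a linear map in its first argument. -/
def insOneLin (sgn : List H → k) (g : List H → H) : (List H → M) →ₗ[k] (List H → M) where
  toFun F := insOne sgn F g
  map_add' F G := by
    funext vs; simp only [insOne, Pi.add_apply, smul_add, splitSum3_add]
  map_smul' c F := by
    funext vs
    simp only [insOne, Pi.smul_apply, RingHom.id_apply, splitSum3_smul, smul_comm c]

/-- `insTwo` as a linear map in its first argument. -/
def insTwoLin (sgn : List H → k) (A B : List H → H) : (List H → M) →ₗ[k] (List H → M) where
  toFun F := insTwo sgn F A B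
  map_add' F G := by
    funext vs; simp only [insTwo, Pi.add_apply, smul_add, splitSum5_add]
  map_smul' c F := by
    funext vs
    simp only [insTwo, Pi.smul_apply, RingHom.id_apply, splitSum5_smul, smul_comm c]

/-- Signed insertion of a vector-valued map `X`, through linear maps `J x z` which extend
`F (x ++ · :: z)` to vectors. -/
def insVec (sgn : List H → k) (J : List H → List H → M →ₗ[k] M) :
    (List H → M) →ₗ[k] (List H → M) where
  toFun X vs := splitSum3 (fun x y z => sgn x • J x z (X y)) vs
  map_add' X Y := by
    funext vs; simp only [Pi.add_apply, map_add, smul_add, splitSum3_add]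
  map_smul' c X := by
    funext vs
    simp only [Pi.smul_apply, map_smul, RingHom.id_apply, splitSum3_smul, smul_comm c]

/-- Signed insertion of an even vector-valued map `X` followed by the odd operation `B`. -/
def insVecLeft (sgn : List H → k) (J : List H → List H → M →ₗ[k] M) (B : List H → H) :
    (List H → M) →ₗ[k] (List H → M) where
  toFun X vs := splitSum5 (fun x y z u w =>
    (sgn x * sgn y * sgn z) • J x (z ++ B u :: w) (X y)) vs
  map_add' X Y := by
    funext vs; simp only [Pi.add_apply, map_add, smul_add, splitSum5_add]
  map_smul' c X := by
    funext vs
    simp only [Pi.smul_apply, map_smul, RingHom.id_apply, splitSum5_smul, smul_comm c]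

/-- Signed insertion of the odd operation `A` followed by an even vector-valued map `X`. -/
def insVecRight (sgn : List H → k) (J : List H → List H → M →ₗ[k] M) (A : List H → H) :
    (List H → M) →ₗ[k] (List H → M) where
  toFun X vs := splitSum5 (fun x y z u w => sgn x • J (x ++ A y :: z) w (X u)) vs
  map_add' X Y := by
    funext vs; simp only [Pi.add_apply, map_add, smul_add, splitSum5_add]
  map_smul' c X := by
    funext vs
    simp only [Pi.smul_apply, map_smul, RingHom.id_apply, splitSum5_smul, smul_comm c]

lemma insVec_comp (sgn : List H → k) (J : List H → List H → M →ₗ[k] M) (inc : H → M)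
    (F : List H → M) (hJ : ∀ x h z, J x z (inc h) = F (x ++ h :: z)) (g : List H → H) :
    insVec sgn J (fun y => inc (g y)) = insOne sgn F g := by
  funext vs; simp only [insVec, insOne, LinearMap.coe_mk, AddHom.coe_mk, hJ]

/-- The brace relation of `insTwo_insOne`, with the composites inserted linearly. -/
theorem insTwo_insOne_eq (sgn : List H → k)
    (happ : ∀ x y, sgn (x ++ y) = sgn x * sgn y) (hsq : ∀ x, sgn x * sgn x = 1)
    (inc : H → M) (F : List H → M) (J : List H → List H → M →ₗ[k] M)
    (hJ : ∀ x h z, J x z (inc h) = F (x ++ h :: z)) (g A B : List H → H)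
    (hg : ∀ y, sgn [g y] = -sgn y) (hA : ∀ y, sgn [A y] = -sgn y)
    (hB : ∀ y, sgn [B y] = -sgn y) :
    insTwo sgn (insOne sgn F g) A B =
      insOne sgn (insTwo sgn F A B) g +
      insVec sgn J (insTwo sgn (fun y => inc (g y)) A B) +
      insVecLeft sgn J B
        (insOne sgn (fun y => inc (g y)) A + insOne sgn (fun y => inc (A y)) g) -
      insVecRight sgn J A
        (insOne sgn (fun y => inc (g y)) B + insOne sgn (fun y => inc (B y)) g) := by
  funext vs
  rw [insTwo_insOne sgn happ hsq F g A B hg hA hB vs]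
  have h3 (x z y : List H) (φ : List H → List H → List H → M) :
      J x z (splitSum3 φ y) = splitSum3 (fun p q r => J x z (φ p q r)) y := by
    simp only [splitSum3, map_splitSum]
  have h5 (x z y : List H) (φ : List H → List H → List H → List H → List H → M) :
      J x z (splitSum5 φ y) = splitSum5 (fun p q r s t => J x z (φ p q r s t)) y := by
    simp only [splitSum5, map_splitSum]
  simp only [Pi.add_apply, Pi.sub_apply, insVec, insVecLeft, insVecRight, LinearMap.coe_mk,
    AddHom.coe_mk, map_add]
  simp only [insOne, insTwo, h3, h5, map_smul, hJ, smul_add, splitSum5_add, List.append_assoc,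
    List.cons_append]

end Insertion

section Convolution

lemma single_one_le {ι : Type*} [DecidableEq ι] {α : MI ι} {i : ι} (h : α i ≠ 0) : Pi.single i 1 ≤ α := by
  intro j
  by_cases hj : j = i
  · subst hj; simpa using Nat.one_le_iff_ne_zero.mpr h
  · simp [hj]

variable {ι : Type*} [Fintype ι] [DecidableEq ι] {M : Type*} [AddCommGroup M]

/-- Sum of `φ β γ` over all decompositions `α = β + γ` of a multi-index. -/
def convSum (φ : MI ι → MI ι → M) (α : MI ι) : M := ∑ β ∈ below ι α, φ β (α - β)

lemma mem_below {α β : MI ι} : β ∈ below ι α ↔ β ≤ α := by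
  simp [below, Pi.le_def]

lemma convSum_congr {φ ψ : MI ι → MI ι → M} {α : MI ι}
    (h : ∀ β γ, β + γ = α → φ β γ = ψ β γ) : convSum φ α = convSum ψ α :=
  Finset.sum_congr rfl fun β hβ => h β _ (add_tsub_cancel_of_le (mem_below.mp hβ))

lemma convSum_eq_zero {φ : MI ι → MI ι → M} {α : MI ι}
    (h : ∀ β γ, β + γ = α → φ β γ = 0) : convSum φ α = 0 :=
  Finset.sum_eq_zero fun β hβ => h β _ (add_tsub_cancel_of_le (mem_below.mp hβ))

lemma convSum_add (φ ψ : MI ι → MI ι → M) (α : MI ι) :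
    convSum (fun β γ => φ β γ + ψ β γ) α = convSum φ α + convSum ψ α :=
  Finset.sum_add_distrib

lemma convSum_sub (φ ψ : MI ι → MI ι → M) (α : MI ι) :
    convSum (fun β γ => φ β γ - ψ β γ) α = convSum φ α - convSum ψ α :=
  Finset.sum_sub_distrib ..

lemma map_convSum {N F : Type*} [AddCommGroup N] [FunLike F M N] [AddMonoidHomClass F M N]
    (f : F) (φ : MI ι → MI ι → M) (α : MI ι) :
    f (convSum φ α) = convSum (fun β γ => f (φ β γ)) α :=
  map_sum f _ _

lemma convSum_comm (φ : MI ι → MI ι → M) (α : MI ι) :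
    convSum φ α = convSum (fun β γ => φ γ β) α := by
  refine Finset.sum_nbij' (fun β => α - β) (fun β => α - β) ?_ ?_ ?_ ?_ ?_
  · intro β _; exact mem_below.mpr tsub_le_self
  · intro β _; exact mem_below.mpr tsub_le_self
  · intro β hβ; exact tsub_tsub_cancel_of_le (mem_below.mp hβ)
  · intro β hβ; exact tsub_tsub_cancel_of_le (mem_below.mp hβ)
  · intro β hβ
    rw [tsub_tsub_cancel_of_le (mem_below.mp hβ)]

lemma convSum_assoc (φ : MI ι → MI ι → MI ι → M) (α : MI ι) :
    convSum (fun ρ c => convSum (fun a b => φ a b c) ρ) α =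
      convSum (fun a ρ => convSum (fun b c => φ a b c) ρ) α := by
  unfold convSum
  rw [Finset.sum_sigma', Finset.sum_sigma']
  refine Finset.sum_nbij' (fun s => ⟨s.2, s.1 - s.2⟩) (fun s => ⟨s.1 + s.2, s.1⟩) ?_ ?_ ?_ ?_ ?_
  · rintro ⟨ρ, a⟩ h
    simp only [Finset.mem_sigma, mem_below] at h ⊢
    exact ⟨h.2.trans h.1, tsub_le_tsub_right h.1 _⟩
  · rintro ⟨a, b⟩ h
    simp only [Finset.mem_sigma, mem_below] at h ⊢
    exact ⟨(add_le_add_right h.2 a).trans (add_tsub_cancel_of_le h.1).le, le_self_add⟩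
  · rintro ⟨ρ, a⟩ h
    simp only [Finset.mem_sigma, mem_below] at h
    simp only [add_tsub_cancel_of_le h.2]
  · rintro ⟨a, b⟩ h
    simp only [add_tsub_cancel_left]
  · rintro ⟨ρ, a⟩ h
    simp only [Finset.mem_sigma, mem_below] at h
    simp only [tsub_tsub, add_tsub_cancel_of_le h.2]

variable {R : Type*} [Field R] [Module R M]

lemma convSum_smul (c : R) (φ : MI ι → MI ι → M) (α : MI ι) :
    c • convSum φ α = convSum (fun β γ => c • φ β γ) α :=
  Finset.smul_sum

lemma convSum_shift_left (φ : MI ι → MI ι → M) (i : ι) (α : MI ι) :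
    convSum (fun β γ => ((β i + 1 : ℕ) : R) • φ (β + Pi.single i 1) γ) α =
      convSum (fun β γ => (β i : R) • φ β γ) (α + Pi.single i 1) := by
  refine Finset.sum_of_injOn (fun β => β + Pi.single i 1) (add_left_injective _).injOn ?_ ?_ ?_
  · intro β hβ
    simp only [Finset.mem_coe, mem_below] at hβ ⊢
    exact add_le_add_left hβ _
  · intro β hβ hn
    have : β i = 0 := by
      by_contra h0
      refine hn ⟨β - Pi.single i 1, ?_, tsub_add_cancel_of_le (single_one_le h0)⟩
      rw [Finset.mem_coe, mem_below] at *
      exact tsub_le_iff_right.mpr hβ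
    simp [this]
  · intro β hβ
    simp [add_tsub_add_eq_tsub_right]

/-- The Leibniz rule for partial derivatives of a Cauchy product. -/
lemma convSum_leibniz (φ : MI ι → MI ι → M) (i : ι) (α : MI ι) :
    convSum (fun β γ => ((γ i + 1 : ℕ) : R) • φ β (γ + Pi.single i 1) +
      ((β i + 1 : ℕ) : R) • φ (β + Pi.single i 1) γ) α =
      ((α i + 1 : ℕ) : R) • convSum φ (α + Pi.single i 1) := by
  rw [convSum_add, convSum_shift_left, convSum_comm, convSum_shift_left (fun β γ => φ γ β),
    convSum_comm, ← convSum_add, convSum_smul]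
  refine convSum_congr fun β γ h => ?_
  have : β i + γ i = α i + 1 := by simpa using congrFun h i
  rw [← this, ← add_smul, Nat.cast_add, add_comm]

end Convolution

section Bracket

variable {ι : Type*} [Fintype ι] [DecidableEq ι] {k : Type*} [Field k] {H M : Type*}
  [AddCommGroup M] [Module k M]

lemma convSum_right_comm (φ : MI ι → MI ι → MI ι → M) (α : MI ι) :
    convSum (fun σ c => convSum (fun a b => φ a b c) σ) α =
      convSum (fun σ b => convSum (fun a c => φ a b c) σ) α := by
  rw [convSum_assoc, convSum_assoc]
  exact convSum_congr fun a _ _ => convSum_comm _ _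

lemma convSum_swap (φ : MI ι → MI ι → MI ι → MI ι → M) (α α' : MI ι) :
    convSum (fun a b => convSum (fun c d => φ a b c d) α') α =
      convSum (fun c d => convSum (fun a b => φ a b c d) α) α' :=
  Finset.sum_comm

/-- The bracket `Â ↦ [g, Â]` of a power series of odd operations `g` with power series of odd
vector-valued maps; `J` extends the coefficients of `g` to vectors in each slot. -/
def insBracket (sgn : List H → k) (J : MI ι → List H → List H → M →ₗ[k] M)
    (g : MI ι → List H → H) : (MI ι → List H → M) →ₗ[k] (MI ι → List H → M) where
  toFun X α := convSum (fun β γ => insVec sgn (J β) (X γ) + insOneLin sgn (g γ) (X β)) α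
  map_add' X Y := by
    funext α
    simp only [Pi.add_apply, map_add, ← convSum_add]
    exact convSum_congr fun β γ _ => by abel
  map_smul' c X := by
    funext α
    simp only [Pi.smul_apply, map_smul, RingHom.id_apply, convSum_smul, smul_add]

lemma insBracket_apply (sgn : List H → k) (J : MI ι → List H → List H → M →ₗ[k] M)
    (g : MI ι → List H → H) (X : MI ι → List H → M) (α : MI ι) :
    insBracket sgn J g X α =
      convSum (fun β γ => insVec sgn (J β) (X γ) + insOneLin sgn (g γ) (X β)) α := rfl

/-- The bracket is linear over scalar power series. -/
lemma insBracket_convSum_smul (sgn : List H → k) (J : MI ι → List H → List H → M →ₗ[k] M)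
    (g : MI ι → List H → H) (c : MI ι → k) (X : MI ι → List H → M) (α : MI ι) :
    insBracket sgn J g (fun α => convSum (fun β γ => c β • X γ) α) α =
      convSum (fun β γ => c β • insBracket sgn J g X γ) α := by
  simp only [insBracket_apply, map_convSum, map_smul, convSum_add, smul_add, convSum_smul]
  congr 1
  · rw [← convSum_assoc, ← convSum_assoc]
    refine convSum_congr fun σ γ _ => ?_
    rw [convSum_comm]
  · rw [convSum_assoc]

/-- The bracket of `g` with its partial derivative is half of the derivative of `[g, g]`. -/
lemma insBracket_deriv (sgn : List H → k) (J : MI ι → List H → List H → M →ₗ[k] M)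
    (g : MI ι → List H → H) (inc : H → M)
    (hJ : ∀ β x h z, J β x z (inc h) = inc (g β (x ++ h :: z))) (i : ι) (α : MI ι) :
    insBracket sgn J g
        (fun β => ((β i + 1 : ℕ) : k) • fun y => inc (g (β + Pi.single i 1) y)) α =
      ((α i + 1 : ℕ) : k) •
        convSum (fun β γ => insOne sgn (fun y => inc (g β y)) (g γ)) (α + Pi.single i 1) := by
  rw [← convSum_leibniz, insBracket_apply]
  refine convSum_congr fun β γ _ => ?_
  rw [map_smul, map_smul, insVec_comp sgn (J β) inc (fun y => inc (g β y)) (hJ β)]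
  rfl

/-- If `g ∘ g`, `[g, A]` and `[g, B]` vanish on a lower set of monomials, so does
`[g, g{A, B}]`. -/
theorem insBracket_insTwo (sgn : List H → k)
    (happ : ∀ x y, sgn (x ++ y) = sgn x * sgn y) (hsq : ∀ x, sgn x * sgn x = 1)
    (inc : H → M) (J : MI ι → List H → List H → M →ₗ[k] M) (g A B : MI ι → List H → H)
    (hJ : ∀ β x h z, J β x z (inc h) = inc (g β (x ++ h :: z)))
    (hg : ∀ β y, sgn [g β y] = -sgn y) (hA : ∀ β y, sgn [A β y] = -sgn y)
    (hB : ∀ β y, sgn [B β y] = -sgn y) {S : Set (MI ι)} (hS : IsLowerSet S)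
    (hgg : ∀ α ∈ S, convSum (fun β γ => insOne sgn (fun y => inc (g β y)) (g γ)) α = 0)
    (hgA : ∀ α ∈ S, insBracket sgn J g (fun β y => inc (A β y)) α = 0)
    (hgB : ∀ α ∈ S, insBracket sgn J g (fun β y => inc (B β y)) α = 0) :
    ∀ α ∈ S, insBracket sgn J g (fun α => convSum (fun β τ => convSum (fun γ κ =>
      insTwo sgn (fun y => inc (g β y)) (A γ) (B κ)) τ) α) α = 0 := by
  intro α hα
  have hle {β γ σ : MI ι} (h : β + γ = σ) (hσ : σ ∈ S) : β ∈ S ∧ γ ∈ S :=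
    ⟨hS (h ▸ le_self_add) hσ, hS (h ▸ le_add_self) hσ⟩
  have hbr {X : MI ι → List H → H} (α : MI ι) :
      insBracket sgn J g (fun β y => inc (X β y)) α = convSum (fun γ ρ =>
        insOne sgn (fun y => inc (g ρ y)) (X γ) + insOne sgn (fun y => inc (X γ y)) (g ρ)) α := by
    rw [insBracket_apply, convSum_add, convSum_add, convSum_comm]
    congr 1
    refine convSum_congr fun β γ _ => ?_
    rw [insVec_comp sgn (J γ) inc (fun y => inc (g γ y)) (hJ γ)]
  have key := convSum_congr (α := α) fun σ ρ (_ : σ + ρ = α) =>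
    convSum_congr (α := σ) fun β τ (_ : β + τ = σ) =>
      convSum_congr (α := τ) fun γ κ (_ : γ + κ = τ) =>
        insTwo_insOne_eq sgn happ hsq inc (fun y => inc (g β y)) (J β) (hJ β) (g ρ) (A γ) (B κ)
          (hg ρ) (hA γ) (hB κ)
  simp only [convSum_add, convSum_sub] at key
  have h1 : convSum (fun σ ρ => convSum (fun β τ => convSum (fun γ κ =>
      insTwo sgn (insOne sgn (fun y => inc (g β y)) (g ρ)) (A γ) (B κ)) τ) σ) α = 0 := by
    rw [convSum_right_comm]
    refine convSum_eq_zero fun σ τ h => ?_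
    rw [convSum_swap]
    refine convSum_eq_zero fun γ κ _ => ?_
    have := congrArg (insTwoLin sgn (A γ) (B κ)) (hgg σ (hle h hα).1)
    rwa [map_convSum, map_zero] at this
  have h2 : convSum (fun σ ρ => convSum (fun β τ => convSum (fun γ κ =>
      insVecLeft sgn (J β) (B κ) (insOne sgn (fun y => inc (g ρ y)) (A γ) +
        insOne sgn (fun y => inc (A γ y)) (g ρ))) τ) σ) α = 0 := by
    rw [convSum_assoc]
    refine convSum_eq_zero fun β σ h => ?_
    rw [convSum_right_comm]
    refine convSum_eq_zero fun τ κ h' => ?_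
    have := congrArg (insVecLeft sgn (J β) (B κ)) (hgA τ (hle h' (hle h hα).2).1)
    rwa [hbr, map_convSum, map_zero] at this
  have h3 : convSum (fun σ ρ => convSum (fun β τ => convSum (fun γ κ =>
      insVecRight sgn (J β) (A γ) (insOne sgn (fun y => inc (g ρ y)) (B κ) +
        insOne sgn (fun y => inc (B κ y)) (g ρ))) τ) σ) α = 0 := by
    rw [convSum_assoc]
    refine convSum_eq_zero fun β σ h => ?_
    rw [convSum_assoc]
    refine convSum_eq_zero fun γ τ h' => ?_
    have := congrArg (insVecRight sgn (J β) (A γ)) (hgB τ (hle h' (hle h hα).2).2)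
    rwa [hbr, map_convSum, map_zero] at this
  rw [h1, h2, h3, add_zero, sub_zero] at key
  rw [insBracket_apply, convSum_add, key, add_comm]
  refine congrArg₂ (· + ·) ?_ ?_
  · simp only [map_convSum]
    rfl
  · simp only [map_convSum]
    rw [← convSum_assoc, convSum_assoc, convSum_assoc]
    refine convSum_congr fun β σ _ => ?_
    rw [convSum_comm]

end Bracket

section GradedMaps

variable (k : Type*) [Field k] {V : ℤ → Type*}

/-- A graded map, viewed as a map into homogeneous elements. -/
def tagged {d : ℤ} (f : E V d) (vs : List (HV V)) : HV V := ⟨d + degSum V vs, f vs⟩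

/-- The Koszul sign `(-1)^{|v₁| + ⋯ + |vₙ|}`. -/
def koszul (vs : List (HV V)) : k := (-1) ^ degSum V vs

lemma degSum_append (xs ys : List (HV V)) :
    degSum V (xs ++ ys) = degSum V xs + degSum V ys := by
  simp [degSum]

lemma degSum_cons (h : HV V) (ys : List (HV V)) : degSum V (h :: ys) = h.1 + degSum V ys := by
  simp [degSum]

lemma koszul_append (xs ys : List (HV V)) :
    koszul k (xs ++ ys) = koszul k xs * koszul k ys := by
  rw [koszul, degSum_append, zpow_add₀ (by simp)]; rfl

lemma neg_one_zpow_mul_self (a : ℤ) : (-1 : k) ^ a * (-1) ^ a = 1 := by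
  rw [← mul_zpow]; simp

lemma koszul_mul_self (xs : List (HV V)) : koszul k xs * koszul k xs = 1 :=
  neg_one_zpow_mul_self k _

lemma neg_one_zpow_odd_mul {a : ℤ} (ha : Odd a) (d : ℤ) : (-1 : k) ^ (a * d) = (-1) ^ d := by
  rw [zpow_mul, ha.neg_one_zpow]

lemma koszul_tagged {d : ℤ} (hd : Odd d) (f : E V d) (vs : List (HV V)) :
    koszul k [tagged f vs] = - koszul k vs := by
  simp [koszul, degSum, tagged, zpow_add₀, hd.neg_one_zpow]

variable [∀ l, AddCommGroup (V l)] [∀ l, Module k (V l)]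

/-- A homogeneous element of `V`, viewed in the direct sum of the components. -/
def toSum (h : HV V) : DirectSum ℤ V := DirectSum.lof k ℤ V h.1 h.2

/-- A graded map, viewed as a map into the direct sum of the components. -/
def untyped {d : ℤ} : E V d →ₗ[k] (List (HV V) → DirectSum ℤ V) where
  toFun f vs := DirectSum.lof k ℤ V (d + degSum V vs) (f vs)
  map_add' f g := by funext vs; simp
  map_smul' c f := by funext vs; simp

lemma toSum_tagged {d : ℤ} (f : E V d) (vs : List (HV V)) :
    toSum k (tagged f vs) = untyped k f vs := rfl

lemma untyped_injective {d : ℤ} : Function.Injective (untyped k : E V d → _) := by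
  intro f g h
  funext vs
  exact DirectSum.of_injective _ (congrFun h vs)

lemma lof_vcast {a b : ℤ} (h : a = b) (x : V a) :
    DirectSum.lof k ℤ V b (vcast V x) = DirectSum.lof k ℤ V a x := by
  subst h; simp [vcast]

lemma untyped_recast {a b : ℤ} (h : a = b) (f : E V a) :
    untyped k (recast V f : E V b) = untyped k f := by
  funext vs; exact lof_vcast k (by rw [h]) _

lemma tagged_recast {a b : ℤ} (h : a = b) (f : E V a) :
    tagged (recast V f : E V b) = tagged f := by
  subst h; funext vs; simp [tagged, recast, vcast]

lemma sum_map_splits3 {H M : Type*} [AddCommGroup M] (φ : List H × List H × List H → M)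
    (vs : List H) :
    ((splits3 vs).map φ).sum = splitSum3 (fun x y z => φ (x, y, z)) vs := by
  simp [splits3, splitSum3, splitSum, List.flatMap, List.sum_flatten, List.map_flatten,
    Function.comp_def]

lemma untyped_gcomp {a b : ℤ} (hb : Odd b) (f : E V a) (g : E V b) :
    untyped k (gcomp k V f g) = insOne (koszul k) (untyped k f) (tagged g) := by
  funext vs
  rw [insOne]
  simp only [untyped, LinearMap.coe_mk, AddHom.coe_mk, gcomp, sum_map_splits3]
  simp only [splitSum3, map_splitSum]
  refine splitSum3_congr fun x y z h => ?_
  subst h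
  rw [map_smul, neg_one_zpow_odd_mul k hb, lof_vcast]
  · rfl
  · simp only [degSum_append, degSum_cons]; ring

lemma untyped_braces {a b c : ℤ} (ha : Odd a) (hb : Odd b) (f : E V c) (A : E V a)
    (B : E V b) :
    untyped k (braces k V f [⟨a, A⟩, ⟨b, B⟩]) =
      insTwo (koszul k) (untyped k f) (tagged A) (tagged B) := by
  funext vs
  rw [insTwo]
  have key (φ : ℤ × List (HV V) → DirectSum ℤ V) :
      ((ins V [⟨a, A⟩, ⟨b, B⟩] vs).map φ).sum =
        splitSum5 (fun x y z u w =>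
          φ (a * degSum V x + b * (degSum V x + degSum V y) + b * degSum V z,
            x ++ tagged A y :: (z ++ tagged B u :: w))) vs := by
    simp [ins, List.flatMap, List.sum_flatten, List.map_flatten, Function.comp_def,
      sum_map_splits3, splitSum5, splitSum3, degl, tagged]
  simp only [untyped, LinearMap.coe_mk, AddHom.coe_mk, braces, map_list_sum, List.map_map, key]
  refine splitSum5_congr fun x y z u w h => ?_
  subst h
  simp only [Function.comp_apply]
  rw [map_smul, lof_vcast]
  · congr 1
    rw [zpow_add₀ (by simp), zpow_add₀ (by simp), neg_one_zpow_odd_mul k ha,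
      neg_one_zpow_odd_mul k hb, neg_one_zpow_odd_mul k hb, zpow_add₀ (by simp), ← mul_assoc,
      neg_one_zpow_mul_self, one_mul]
    rfl
  · simp only [degSum_append, degSum_cons, degl, tagged, List.map_cons, List.map_nil,
      List.sum_cons, List.sum_nil]
    ring

end GradedMaps

section Multilinear

variable (k : Type*) [Field k] {V : ℤ → Type*} [∀ l, AddCommGroup (V l)] [∀ l, Module k (V l)]
  {M : Type*} [AddCommGroup M] [Module k M]

/-- Functions on lists of homogeneous elements which are linear in every slot. -/
def multilinear (V : ℤ → Type*) [∀ l, AddCommGroup (V l)] [∀ l, Module k (V l)]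
    (M : Type*) [AddCommGroup M] [Module k M] : Submodule k (List (HV V) → M) where
  carrier := {F | ∀ (x z : List (HV V)) (l : ℤ), IsLinearMap k fun v : V l => F (x ++ ⟨l, v⟩ :: z)}
  add_mem' hF hG x z l :=
    ⟨fun v w => by simp only [Pi.add_apply, (hF x z l).map_add, (hG x z l).map_add]; abel,
      fun c v => by simp only [Pi.add_apply, (hF x z l).map_smul, (hG x z l).map_smul, smul_add]⟩
  zero_mem' x z l := ⟨fun v w => by simp, fun c v => by simp⟩
  smul_mem' c F hF x z l :=
    ⟨fun v w => by simp only [Pi.smul_apply, (hF x z l).map_add, smul_add],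
      fun d v => by simp only [Pi.smul_apply, (hF x z l).map_smul, smul_comm c d]⟩

open Classical in
/-- The linear extension of a multilinear map in one slot to the direct sum. -/
noncomputable def slot (F : List (HV V) → M) (x z : List (HV V)) : DirectSum ℤ V →ₗ[k] M :=
  if hF : F ∈ multilinear k V M then
    DirectSum.toModule k ℤ M fun l => (hF x z l).mk' _
  else 0

lemma slot_toSum {F : List (HV V) → M} (hF : F ∈ multilinear k V M) (x : List (HV V)) (h : HV V)
    (z : List (HV V)) : slot k F x z (toSum k h) = F (x ++ h :: z) := by
  simp [slot, hF, toSum]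

lemma IsMultilinear.untyped_mem {d : ℤ} {f : E V d} (hf : IsMultilinear k V f) :
    untyped k f ∈ multilinear k V (DirectSum ℤ V) := by
  intro x z l
  have key (v : V l) : untyped k f (x ++ ⟨l, v⟩ :: z) =
      DirectSum.lof k ℤ V _ (vcast V (f (x ++ ⟨l, v⟩ :: z)) :
        V (d + degSum V x + l + degSum V z)) := by
    rw [lof_vcast]
    · rfl
    · simp only [degSum_append, degSum_cons]; ring
  refine ⟨fun v w => ?_, fun c v => ?_⟩
  · rw [key, key, key, hf.1, map_add]
  · rw [key, key, hf.2, map_smul]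

lemma isLinearMap_add {N : Type*} [AddCommGroup N] [Module k N] {f g : N → M}
    (hf : IsLinearMap k f) (hg : IsLinearMap k g) : IsLinearMap k fun v => f v + g v :=
  (hf.mk' + hg.mk').isLinear

lemma isLinearMap_splitSum {N H : Type*} [AddCommGroup N] [Module k N]
    {φ : N → List H → List H → M} (h : ∀ p q, IsLinearMap k fun v => φ v p q) (vs : List H) :
    IsLinearMap k fun v => splitSum (φ v) vs := by
  refine ⟨fun v w => ?_, fun c v => ?_⟩
  · rw [← splitSum_add]
    exact splitSum_congr fun p q _ => (h p q).map_add v w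
  · rw [splitSum_smul]
    exact splitSum_congr fun p q _ => (h p q).map_smul c v

/-- Inserting multilinear maps into a multilinear map gives a multilinear map. -/
lemma insTwo_mem_multilinear {a b : ℤ} {F : List (HV V) → M} (hF : F ∈ multilinear k V M)
    {A : E V a} (hA : untyped k A ∈ multilinear k V (DirectSum ℤ V))
    {B : E V b} (hB : untyped k B ∈ multilinear k V (DirectSum ℤ V)) :
    insTwo (koszul k) F (tagged A) (tagged B) ∈ multilinear k V M := by
  intro x z l
  have hsgn (p q : List (HV V)) (v : V l) :
      koszul k (p ++ ⟨l, v⟩ :: q) = koszul k (p ++ ⟨l, 0⟩ :: q) := by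
    simp only [koszul, degSum_append, degSum_cons]
  have hF' (c : k) (p q : List (HV V)) :
      IsLinearMap k fun v : V l => c • F (p ++ ⟨l, v⟩ :: q) :=
    (c • (hF p q l).mk').isLinear
  have hFX (c : k) (p q r s : List (HV V)) {d : ℤ} {X : E V d}
      (hX : untyped k X ∈ multilinear k V (DirectSum ℤ V)) :
      IsLinearMap k fun v : V l => c • F (p ++ tagged X (r ++ ⟨l, v⟩ :: s) :: q) := by
    simp only [← slot_toSum k hF, toSum_tagged]
    exact (c • (slot k F p q).comp (hX r s l).mk').isLinear
  simp only [insTwo, splitSum5_insert]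
  refine isLinearMap_add k (isLinearMap_add k (isLinearMap_add k (isLinearMap_add k ?_ ?_) ?_) ?_)
    ?_ <;> try simp only [splitSum3, splitSum5]
  all_goals repeat' refine isLinearMap_splitSum k (fun _ _ => ?_) _
  · simpa only [List.append_assoc, List.cons_append] using hF' _ _ _
  · simpa only [hsgn] using hFX _ _ _ _ _ hA
  · simpa only [hsgn, List.append_assoc, List.cons_append] using
      hF' _ (_ ++ tagged A _ :: _) _
  · simpa only [List.append_assoc, List.cons_append] using hFX _ (_ ++ tagged A _ :: _) _ _ _ hB
  · simpa only [List.append_assoc, List.cons_append] using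
      hF' _ (_ ++ tagged A _ :: (_ ++ tagged B _ :: _)) _

end Multilinear

section GradedSeries

variable (k : Type*) [Field k] {V : ℤ → Type*} [∀ l, AddCommGroup (V l)] [∀ l, Module k (V l)]
  {ι : Type*} [Fintype ι] {td : ι → ℤ}

lemma even_degM (htd : ∀ i, Even (td i)) (α : MI ι) : Even (degM ι td α) :=
  Finset.even_sum _ fun i _ => (htd i).mul_left _

lemma degM_add (α β : MI ι) : degM ι td (α + β) = degM ι td α + degM ι td β := by
  simp [degM, add_mul, Finset.sum_add_distrib]

/-- A power series of graded maps, viewed as a power series of maps into the direct sum. -/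
def untypedSeries {d : ℤ} (F : PS V ι td d) (α : MI ι) : List (HV V) → DirectSum ℤ V :=
  untyped k (F α)

lemma untypedSeries_injective {d : ℤ} :
    Function.Injective (untypedSeries k : PS V ι td d → _) := by
  intro F G h
  funext α
  exact untyped_injective k (congrFun h α)

lemma untypedSeries_precast {a b : ℤ} (h : a = b) (F : PS V ι td a) :
    untypedSeries k (precast V ι td F : PS V ι td b) = untypedSeries k F := by
  subst h; funext α; exact untyped_recast k rfl _

lemma untypedSeries_add {d : ℤ} (F G : PS V ι td d) :
    untypedSeries k (F + G) = untypedSeries k F + untypedSeries k G := by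
  funext α; exact map_add _ _ _

lemma untypedSeries_zero {d : ℤ} : untypedSeries k (0 : PS V ι td d) = 0 := by
  funext α; exact map_zero _

variable [DecidableEq ι]

lemma degM_single (i : ι) : degM ι td (Pi.single i 1) = td i := by
  simp [degM, Pi.single_apply]

lemma degM_sub {α β : MI ι} (h : β ∈ below ι α) :
    degM ι td (α - β) = degM ι td α - degM ι td β := by
  rw [eq_sub_iff_add_eq', ← degM_add, add_tsub_cancel_of_le (mem_below.mp h)]

lemma untypedSeries_pcomp (htd : ∀ i, Even (td i)) {a b : ℤ} (hb : Odd b) (F : PS V ι td a)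
    (G : PS V ι td b) :
    untypedSeries k (pcomp k V ι td F G) = convSum fun β γ =>
      insOne (koszul k) (untypedSeries k F β) (tagged (G γ)) := by
  funext α
  simp only [untypedSeries, pcomp, map_sum]
  refine Finset.sum_congr rfl fun β hβ => ?_
  rw [untyped_recast, untyped_gcomp k (hb.sub_even (even_degM htd _))]
  rw [degM_sub hβ]; ring

lemma untypedSeries_pcup (htd : ∀ i, Even (td i)) {a b : ℤ} (ha : Odd a) (hb : Odd b)
    (m : PS V ι td 1) (A : PS V ι td a) (B : PS V ι td b) :
    untypedSeries k (pcup k V ι td m A B) = convSum fun β τ => convSum (fun γ κ =>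
      insTwo (koszul k) (untypedSeries k m β) (tagged (A γ)) (tagged (B κ))) τ := by
  funext α
  rw [pcup, (ha.sub_odd odd_one).neg_one_zpow, one_smul]
  simp only [untypedSeries, pbr2, map_sum]
  refine Finset.sum_congr rfl fun β hβ => Finset.sum_congr rfl fun γ hγ => ?_
  rw [untyped_recast, untyped_braces k (ha.sub_even (even_degM htd _))
    (hb.sub_even (even_degM htd _))]
  simp only [degl, List.map_cons, List.map_nil, List.sum_cons, List.sum_nil]
  rw [degM_sub hγ, degM_sub hβ]; ring

lemma untypedSeries_pderiv {d : ℤ} (F : PS V ι td d) (i : ι) :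
    untypedSeries k (pderiv k V ι td F i) = fun α =>
      ((α i + 1 : ℕ) : k) • untypedSeries k F (α + Pi.single i 1) := by
  funext α
  simp only [untypedSeries, pderiv, map_smul]
  rw [untyped_recast]
  rw [degM_add, degM_single]; ring

lemma recast_of_ne {a b : ℤ} (h : a ≠ b) (f : E V a) : (recast V f : E V b) = 0 := by
  funext vs
  exact dif_neg fun h' => h (add_right_cancel h')

lemma untypedSeries_csmul (c : MI ι → k) {a : ℤ} (A : PS V ι td a) (e : ℤ) :
    untypedSeries k (csmul k V ι td c A e) = convSum fun β γ =>
      (if degM ι td β = e - a then c β else 0) • untypedSeries k A γ := by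
  funext α
  simp only [untypedSeries, csmul, map_sum, map_smul]
  refine Finset.sum_congr rfl fun β hβ => ?_
  dsimp only
  split_ifs with h
  · rw [untyped_recast]
    rw [degM_sub hβ, h]; ring
  · rw [recast_of_ne, map_zero, smul_zero, zero_smul]
    rw [degM_sub hβ]
    contrapose! h
    linarith

/-- The Gerstenhaber bracket with `g`, acting on power series of odd maps. -/
noncomputable def seriesBracket (g : PS V ι td 1) :
    (MI ι → List (HV V) → DirectSum ℤ V) →ₗ[k] (MI ι → List (HV V) → DirectSum ℤ V) :=
  insBracket (koszul k) (fun β => slot k (untypedSeries k g β)) fun β => tagged (g β)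

/-- All coefficients of the power series are multilinear. -/
def MultilinearSeries {d : ℤ} (F : PS V ι td d) : Prop :=
  ∀ α, untypedSeries k F α ∈ multilinear k V (DirectSum ℤ V)

lemma seriesBracket_pderiv (htd : ∀ i, Even (td i)) {g : PS V ι td 1}
    (hg : MultilinearSeries k g) (i : ι) (α : MI ι) :
    seriesBracket k g (untypedSeries k (pderiv k V ι td g i)) α =
      ((α i + 1 : ℕ) : k) • untypedSeries k (pcomp k V ι td g g) (α + Pi.single i 1) := by
  rw [untypedSeries_pderiv, untypedSeries_pcomp k htd odd_one]
  exact insBracket_deriv _ _ _ (toSum k) (fun β x h z => slot_toSum k (hg β) x h z) i α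

lemma seriesBracket_pcup (htd : ∀ i, Even (td i)) {g : PS V ι td 1}
    (hg : MultilinearSeries k g) {S : Set (MI ι)} (hS : IsLowerSet S)
    (hgg : ∀ α ∈ S, untypedSeries k (pcomp k V ι td g g) α = 0)
    {a b : ℤ} (ha : Odd a) (hb : Odd b) {A : PS V ι td a} {B : PS V ι td b}
    (hA : ∀ α ∈ S, seriesBracket k g (untypedSeries k A) α = 0)
    (hB : ∀ α ∈ S, seriesBracket k g (untypedSeries k B) α = 0) :
    ∀ α ∈ S, seriesBracket k g (untypedSeries k (pcup k V ι td g A B)) α = 0 := by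
  rw [untypedSeries_pcomp k htd odd_one] at hgg
  rw [untypedSeries_pcup k htd ha hb]
  have hodd {d : ℤ} (hd : Odd d) (X : PS V ι td d) (β : MI ι) (y : List (HV V)) :
      koszul k [tagged (X β) y] = - koszul k y :=
    koszul_tagged k (hd.sub_even (even_degM htd _)) _ _
  exact insBracket_insTwo _ (koszul_append k) (koszul_mul_self k) (toSum k) _
    (fun β => tagged (g β)) (fun β => tagged (A β)) (fun β => tagged (B β))
    (fun β x h z => slot_toSum k (hg β) x h z)
    (hodd odd_one g) (hodd ha A) (hodd hb B) hS hgg hA hB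

lemma seriesBracket_csmul {g : PS V ι td 1} {S : Set (MI ι)} (hS : IsLowerSet S) (c : MI ι → k)
    {a : ℤ} {A : PS V ι td a} (e : ℤ)
    (hA : ∀ α ∈ S, seriesBracket k g (untypedSeries k A) α = 0) :
    ∀ α ∈ S, seriesBracket k g (untypedSeries k (csmul k V ι td c A e)) α = 0 := by
  intro α hα
  rw [untypedSeries_csmul]
  refine (insBracket_convSum_smul _ _ _ _ _ α).trans (convSum_eq_zero fun β γ h => ?_)
  exact (congrArg _ (hA γ (hS (h ▸ le_add_self) hα))).trans (smul_zero _)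

lemma MultilinearSeries.pderiv {d : ℤ} {F : PS V ι td d} (hF : MultilinearSeries k F) (i : ι) :
    MultilinearSeries k (pderiv k V ι td F i) := by
  intro α
  rw [untypedSeries_pderiv]
  exact Submodule.smul_mem _ _ (hF _)

lemma MultilinearSeries.pcup (htd : ∀ i, Even (td i)) {a b : ℤ} (ha : Odd a) (hb : Odd b)
    {m : PS V ι td 1} {A : PS V ι td a} {B : PS V ι td b} (hm : MultilinearSeries k m)
    (hA : MultilinearSeries k A) (hB : MultilinearSeries k B) :
    MultilinearSeries k (pcup k V ι td m A B) := by
  intro α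
  rw [untypedSeries_pcup k htd ha hb]
  exact Submodule.sum_mem _ fun β _ => Submodule.sum_mem _ fun γ _ =>
    insTwo_mem_multilinear k (hm _) (hA _) (hB _)

lemma MultilinearSeries.csmul (c : MI ι → k) {a : ℤ} {A : PS V ι td a}
    (hA : MultilinearSeries k A) (e : ℤ) : MultilinearSeries k (csmul k V ι td c A e) := by
  intro α
  rw [untypedSeries_csmul]
  exact Submodule.sum_mem _ fun β _ => Submodule.smul_mem _ _ (hA _)

/-- Induction over the iterated cup products of partial derivatives. -/
lemma cupIter_induction (htd : ∀ i, Even (td i)) (m : PS V ι td 1)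
    {P : ∀ ⦃d : ℤ⦄, PS V ι td d → Prop} {I : Set ι}
    (hderiv : ∀ i ∈ I, P (Ainf.pderiv k V ι td m i))
    (hcup : ∀ (a b : ℤ) (A : PS V ι td a) (B : PS V ι td b), Odd a → Odd b → P A → P B →
      P (Ainf.pcup k V ι td m A B))
    {i : ι} (hi : i ∈ I) {is : List ι} (his : ∀ j ∈ is, j ∈ I) :
    P (cupIter k V ι td m i is).2 := by
  have h1 (j : ι) : Odd (1 - td j) := odd_one.sub_even (htd j)
  suffices H : ∀ acc : Σ d : ℤ, PS V ι td d, Odd acc.1 → P acc.2 →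
      P (is.foldl (fun acc i => (⟨acc.1 + (1 - td i) + 1,
        Ainf.pcup k V ι td m acc.2 (Ainf.pderiv k V ι td m i)⟩ : Σ d : ℤ, PS V ι td d)) acc).2 from
    H _ (h1 i) (hderiv i hi)
  induction is with
  | nil => exact fun acc _ h => h
  | cons j is ih =>
    intro acc hodd hP
    refine ih (fun l hl => his l (List.mem_cons_of_mem _ hl)) _ ?_ ?_
    · exact (hodd.add_odd (h1 j)).add_one
    · exact hcup _ _ _ _ hodd (h1 j) hP (hderiv j (his j List.mem_cons_self))

/-- Induction over the terms of a cup polynomial. -/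
lemma deltaEval_induction (htd : ∀ i, Even (td i)) (m : PS V ι td 1) {δ : ℤ}
    {P : ∀ ⦃d : ℤ⦄, PS V ι td d → Prop} {I : Set ι}
    (hderiv : ∀ i ∈ I, P (Ainf.pderiv k V ι td m i))
    (hcup : ∀ (a b : ℤ) (A : PS V ι td a) (B : PS V ι td b), Odd a → Odd b → P A → P B →
      P (Ainf.pcup k V ι td m A B))
    (hsmul : ∀ (c : MI ι → k) (a : ℤ) (A : PS V ι td a), P A → P (Ainf.csmul k V ι td c A δ))
    (hzero : P (0 : PS V ι td δ)) (hadd : ∀ A B : PS V ι td δ, P A → P B → P (A + B))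
    {ts : List ((MI ι → k) × ι × List ι)} (hts : ∀ t ∈ ts, ∀ i ∈ t.2.1 :: t.2.2, i ∈ I) :
    P (deltaEval k V ι td m δ ts) := by
  induction ts with
  | nil => exact hzero
  | cons t ts ih =>
    rw [deltaEval, List.map_cons, List.sum_cons]
    have ht := hts t List.mem_cons_self
    refine hadd _ _ (hsmul _ _ _ ?_) (ih fun s hs => hts s (List.mem_cons_of_mem _ hs))
    exact cupIter_induction k htd m hderiv hcup (ht _ List.mem_cons_self)
      fun j hj => ht j (List.mem_cons_of_mem _ hj)

lemma MultilinearSeries.deltaEval (htd : ∀ i, Even (td i)) {m : PS V ι td 1}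
    (hm : MultilinearSeries k m) (δ : ℤ) (ts : List ((MI ι → k) × ι × List ι)) :
    MultilinearSeries k (deltaEval k V ι td m δ ts) := by
  refine deltaEval_induction k htd m (P := fun d A => MultilinearSeries k A) (I := Set.univ)
    (fun i _ => hm.pderiv k i) (fun a b A B ha hb hA hB => hm.pcup k htd ha hb hA hB)
    (fun c a A hA => hA.csmul k c _) ?_ ?_ fun _ _ _ _ => Set.mem_univ _
  · intro α
    rw [untypedSeries_zero]
    exact Submodule.zero_mem _
  · intro A B hA hB α
    rw [untypedSeries_add]
    exact Submodule.add_mem _ (hA α) (hB α)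

/-- A cup polynomial in partial derivatives of `g` commutes with `g`, on a lower set of monomials
on which `g ∘ g` and the relevant partial derivatives of it vanish. -/
lemma seriesBracket_deltaEval (htd : ∀ i, Even (td i)) {g : PS V ι td 1}
    (hg : MultilinearSeries k g) {S : Set (MI ι)} (hS : IsLowerSet S) {I : Set ι}
    (hSI : ∀ i ∈ I, ∀ α ∈ S, α + Pi.single i 1 ∈ S)
    (hgg : ∀ α ∈ S, untypedSeries k (pcomp k V ι td g g) α = 0) (δ : ℤ)
    {ts : List ((MI ι → k) × ι × List ι)} (hts : ∀ t ∈ ts, ∀ i ∈ t.2.1 :: t.2.2, i ∈ I) :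
    ∀ α ∈ S, seriesBracket k g (untypedSeries k (deltaEval k V ι td g δ ts)) α = 0 := by
  refine deltaEval_induction k htd g
    (P := fun d A => ∀ α ∈ S, seriesBracket k g (untypedSeries k A) α = 0) ?_
    (fun a b A B ha hb hA hB => seriesBracket_pcup k htd hg hS hgg ha hb hA hB)
    (fun c a A hA => seriesBracket_csmul k hS c _ hA) ?_ ?_ hts
  · intro i hi α hα
    rw [seriesBracket_pderiv k htd hg, hgg _ (hSI i hi α hα), smul_zero]
  · intro α _
    rw [untypedSeries_zero, map_zero]; rfl
  · intro A B hA hB α hα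
    rw [untypedSeries_add, map_add, Pi.add_apply, hA α hα, hB α hα, add_zero]

/-- On a lower set of monomials closed under the relevant shifts, the value of a cup polynomial
depends only on the coefficients of the family in this set. -/
lemma deltaEval_congr {g g' : PS V ι td 1} {S : Set (MI ι)} (hS : IsLowerSet S) {I : Set ι}
    (hSI : ∀ i ∈ I, ∀ α ∈ S, α + Pi.single i 1 ∈ S) (h : ∀ α ∈ S, g α = g' α) (δ : ℤ)
    {ts : List ((MI ι → k) × ι × List ι)} (hts : ∀ t ∈ ts, ∀ i ∈ t.2.1 :: t.2.2, i ∈ I) :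
    ∀ α ∈ S, deltaEval k V ι td g δ ts α = deltaEval k V ι td g' δ ts α := by
  have hderiv (i : ι) (hi : i ∈ I) (α : MI ι) (hα : α ∈ S) :
      Ainf.pderiv k V ι td g i α = Ainf.pderiv k V ι td g' i α := by
    rw [Ainf.pderiv, Ainf.pderiv, h _ (hSI i hi α hα)]
  have hcup {a b : ℤ} {A A' : PS V ι td a} {B B' : PS V ι td b} (hA : ∀ α ∈ S, A α = A' α)
      (hB : ∀ α ∈ S, B α = B' α) (α : MI ι) (hα : α ∈ S) :
      Ainf.pcup k V ι td g A B α = Ainf.pcup k V ι td g' A' B' α := by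
    have hsub {β : MI ι} : α - β ∈ S := hS tsub_le_self hα
    simp only [Ainf.pcup, Pi.smul_apply, pbr2]
    refine congrArg _ (Finset.sum_congr rfl fun β hβ => Finset.sum_congr rfl fun γ hγ => ?_)
    rw [h β (hS (mem_below.mp hβ) hα), hA γ (hS (mem_below.mp hγ) hsub),
      hB _ (hS tsub_le_self hsub)]
  have hiter (i : ι) (is : List ι) (his : ∀ j ∈ i :: is, j ∈ I) :
      ∃ (d : ℤ) (A A' : PS V ι td d), cupIter k V ι td g i is = ⟨d, A⟩ ∧
        cupIter k V ι td g' i is = ⟨d, A'⟩ ∧ ∀ α ∈ S, A α = A' α := by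
    induction is using List.reverseRecOn with
    | nil => exact ⟨_, _, _, rfl, rfl, hderiv i (his i List.mem_cons_self)⟩
    | append_singleton is j ih =>
      obtain ⟨d, A, A', hA, hA', hAA⟩ := ih fun l hl => his l (by
        simp only [List.mem_cons, List.mem_append] at hl ⊢; tauto)
      refine ⟨_, _, _, ?_, ?_, hcup hAA (hderiv j (his j (by simp)))⟩
      · rw [cupIter] at hA ⊢
        rw [List.foldl_append, hA]; rfl
      · rw [cupIter] at hA' ⊢
        rw [List.foldl_append, hA']; rfl
  intro α hα
  have hsmul (c : MI ι → k) {d : ℤ} {A A' : PS V ι td d} (hA : ∀ α ∈ S, A α = A' α) :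
      Ainf.csmul k V ι td c A δ α = Ainf.csmul k V ι td c A' δ α :=
    Finset.sum_congr rfl fun β _ => by rw [hA _ (hS tsub_le_self hα)]
  have hterm (c : MI ι → k) (X X' : Σ d : ℤ, PS V ι td d) (hX : ∃ (d : ℤ) (A A' : PS V ι td d),
      X = ⟨d, A⟩ ∧ X' = ⟨d, A'⟩ ∧ ∀ α ∈ S, A α = A' α) :
      Ainf.csmul k V ι td c X.2 δ α = Ainf.csmul k V ι td c X'.2 δ α := by
    obtain ⟨d, A, A', rfl, rfl, hA⟩ := hX
    exact hsmul c hA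
  induction ts with
  | nil => simp only [Ainf.deltaEval, List.map_nil]
  | cons t ts ih =>
    have ih := ih fun s hs => hts s (List.mem_cons_of_mem _ hs)
    simp only [Ainf.deltaEval, List.map_cons, List.sum_cons, Pi.add_apply] at ih ⊢
    rw [ih, hterm _ _ _ (hiter t.2.1 t.2.2 (hts t List.mem_cons_self))]

end GradedSeries

/-- A map on dependent functions which is contracting for a rank function on the indices has a
unique fixed point, and the fixed point inherits pointwise invariants of the map. -/
lemma exists_unique_fixedPoint {A : Type*} {X : A → Type*} (r : A → ℕ)
    (Φ : (∀ α, X α) → ∀ α, X α)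
    (hΦ : ∀ N g g', (∀ α, r α < N → g α = g' α) → ∀ α, r α < N + 1 → Φ g α = Φ g' α)
    (P : ∀ α, X α → Prop) (hP : ∀ g, (∀ α, P α (g α)) → ∀ α, P α (Φ g α))
    (x : ∀ α, X α) (hx : ∀ α, P α (x α)) :
    ∃ g, Φ g = g ∧ (∀ g', Φ g' = g' → g' = g) ∧ ∀ α, P α (g α) := by
  have hstep (n : ℕ) : ∀ α, r α < n → Φ^[n] x α = Φ^[n + 1] x α := by
    induction n with
    | zero => intro α h; omega
    | succ n ih =>
      intro α h
      rw [Function.iterate_succ_apply' Φ n, Function.iterate_succ_apply' Φ (n + 1)]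
      exact hΦ n _ _ ih α h
  have hstable (n m : ℕ) (hnm : n ≤ m) (α : A) (h : r α < n) : Φ^[n] x α = Φ^[m] x α := by
    induction m, hnm using Nat.le_induction with
    | base => rfl
    | succ m hm ih => exact ih.trans (hstep m α (by omega))
  have hfix : Φ (fun α => Φ^[r α + 1] x α) = fun α => Φ^[r α + 1] x α := by
    funext α
    rw [hstep _ _ (Nat.lt_succ_self _), Function.iterate_succ_apply' Φ (r α + 1)]
    exact hΦ (r α + 1) _ _ (fun β hβ => hstable _ _ (by omega) β (by omega)) α (by omega)
  refine ⟨_, hfix, fun g' hg' => ?_, fun α => ?_⟩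
  · have key (N : ℕ) : ∀ α, r α < N → g' α = Φ^[r α + 1] x α := by
      induction N with
      | zero => intro α h; omega
      | succ N ih =>
        intro α h
        have := hΦ N _ _ ih α h
        rwa [hg', hfix] at this
    funext α
    exact key _ α (Nat.lt_succ_self _)
  · have hn (n : ℕ) : ∀ α, P α (Φ^[n] x α) := by
      induction n with
      | zero => exact hx
      | succ n ih => rw [Function.iterate_succ_apply']; exact hP _ ih
    exact hn _ α

section Solution

variable {k : Type*} [Field k] {V : ℤ → Type*} [∀ l, AddCommGroup (V l)] [∀ l, Module k (V l)]
  {n : ℕ} {td : Fin n → ℤ} {δ : ℤ}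

lemma even_tdx (hEven : ∀ i, Even (td i)) (hδ : Odd δ) (i : Fin (n + 1)) :
    Even (tdx td δ i) :=
  Fin.cases (odd_one.sub_odd hδ) hEven i

lemma degM_tdx_cons (α : Fin n → ℕ) :
    degM (Fin (n + 1)) (tdx td δ) (Fin.cons 0 α) = degM (Fin n) td α := by
  simp [degM, tdx, Fin.sum_univ_succ]

lemma liftTerm_index_mem {ts : List (((Fin n → ℕ) → k) × Fin n × List (Fin n))} :
    ∀ t ∈ ts.map (liftTerm k), ∀ i ∈ t.2.1 :: t.2.2, i ∈ Set.range (Fin.succ : Fin n → _) := by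
  intro t ht i hi
  obtain ⟨s, -, rfl⟩ := List.mem_map.mp ht
  rw [liftTerm, List.mem_cons] at hi
  obtain rfl | hi := hi
  · exact ⟨_, rfl⟩
  · obtain ⟨j, -, rfl⟩ := List.mem_map.mp hi
    exact ⟨_, rfl⟩

lemma add_single_succ_zero {i : Fin (n + 1)} (hi : i ∈ Set.range (Fin.succ : Fin n → _))
    (α : MI (Fin (n + 1))) : (α + Pi.single i 1 : MI (Fin (n + 1))) 0 = α 0 := by
  obtain ⟨j, rfl⟩ := hi
  simp

lemma cons_zero_tail {α : MI (Fin (n + 1))} (h : α 0 = 0) :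
    (Fin.cons 0 (fun i => α i.succ) : Fin (n + 1) → ℕ) = α := by
  rw [← h]; exact Fin.cons_self_tail α

/-- The integral operator whose fixed points are the inner deformations of `m`. -/
def integralOperator (m : PS V (Fin n) td 1)
    (ts : List (((Fin n → ℕ) → k) × Fin n × List (Fin n)))
    (g : PS V (Fin (n + 1)) (tdx td δ) 1) : PS V (Fin (n + 1)) (tdx td δ) 1 := fun α =>
  if α 0 = 0 then recast V (m fun i => α i.succ)
  else (α 0 : k)⁻¹ • recast V
    (deltaEval k V (Fin (n + 1)) (tdx td δ) g δ (ts.map (liftTerm k)) (α - Pi.single 0 1))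

lemma untypedSeries_integralOperator (m : PS V (Fin n) td 1)
    (ts : List (((Fin n → ℕ) → k) × Fin n × List (Fin n)))
    (g : PS V (Fin (n + 1)) (tdx td δ) 1) (α : MI (Fin (n + 1))) :
    untypedSeries k (integralOperator m ts g) α =
      if α 0 = 0 then untypedSeries k m (fun i => α i.succ) else (α 0 : k)⁻¹ • untypedSeries k
        (deltaEval k V (Fin (n + 1)) (tdx td δ) g δ (ts.map (liftTerm k)))
        (α - Pi.single 0 1) := by
  unfold untypedSeries integralOperator
  split_ifs with h
  · rw [untyped_recast]
    conv_rhs => rw [← cons_zero_tail h]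
    rw [degM_tdx_cons]
  · rw [map_smul, untyped_recast]
    have : Pi.single 0 1 ∈ below (Fin (n + 1)) α :=
      mem_below.mpr (single_one_le h)
    rw [degM_sub this, degM_single, tdx, Fin.cons_zero]; ring

lemma isSol_iff_integralOperator [CharZero k] (m : PS V (Fin n) td 1)
    (ts : List (((Fin n → ℕ) → k) × Fin n × List (Fin n)))
    (g : PS V (Fin (n + 1)) (tdx td δ) 1) :
    IsSol k V td δ m ts g ↔ integralOperator m ts g = g := by
  have hinit (α : Fin n → ℕ) : g (Fin.cons 0 α) = recast V (m α) ↔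
      untypedSeries k g (Fin.cons 0 α) = untypedSeries k m α := by
    rw [← (untyped_injective k).eq_iff, untyped_recast k (by rw [degM_tdx_cons])]
    rfl
  have hode : pderiv k V (Fin (n + 1)) (tdx td δ) g 0 = precast V (Fin (n + 1)) (tdx td δ)
        (deltaEval k V (Fin (n + 1)) (tdx td δ) g δ (ts.map (liftTerm k))) ↔
      ∀ α, ((α 0 + 1 : ℕ) : k) • untypedSeries k g (α + Pi.single 0 1) = untypedSeries k
        (deltaEval k V (Fin (n + 1)) (tdx td δ) g δ (ts.map (liftTerm k))) α := by
    rw [← (untypedSeries_injective k).eq_iff, untypedSeries_precast k (by simp [tdx]),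
      untypedSeries_pderiv, funext_iff]
  rw [IsSol, hode, ← (untypedSeries_injective k).eq_iff, funext_iff]
  simp only [hinit, untypedSeries_integralOperator]
  constructor
  · rintro ⟨h0, h1⟩ α
    split_ifs with h
    · rw [← h0, cons_zero_tail h]
    · have hα : α - Pi.single 0 1 + Pi.single 0 1 = α :=
        tsub_add_cancel_of_le (single_one_le ‹_›)
      rw [← h1, hα]
      have : (α - Pi.single 0 1 : MI (Fin (n + 1))) 0 + 1 = α 0 := by
        conv_rhs => rw [← hα]
        simp
      rw [this, inv_smul_smul₀ (Nat.cast_ne_zero.mpr h)]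
  · refine fun h => ⟨fun α => ?_, fun α => ?_⟩
    · rw [← h, if_pos (Fin.cons_zero _ _)]
      simp only [Fin.cons_succ]
    · rw [← h, if_neg (by simp), add_tsub_cancel_right]
      have : (α + Pi.single 0 1 : MI (Fin (n + 1))) 0 = α 0 + 1 := by simp
      rw [this, smul_inv_smul₀ (Nat.cast_ne_zero.mpr (Nat.succ_ne_zero _))]

lemma integralOperator_congr (m : PS V (Fin n) td 1)
    (ts : List (((Fin n → ℕ) → k) × Fin n × List (Fin n))) (N : ℕ)
    (g g' : PS V (Fin (n + 1)) (tdx td δ) 1) (h : ∀ α, α 0 < N → g α = g' α)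
    (α : MI (Fin (n + 1))) (hα : α 0 < N + 1) :
    integralOperator m ts g α = integralOperator m ts g' α := by
  unfold integralOperator
  split_ifs with h0
  · rfl
  · rw [deltaEval_congr k (S := {α | α 0 < N}) (fun α β hβ hα => (hβ 0).trans_lt hα)
      (fun i hi α hα => by rwa [Set.mem_ofPred_eq, add_single_succ_zero hi]) h δ liftTerm_index_mem]
    simp only [Set.mem_ofPred_eq, Pi.sub_apply, Pi.single_eq_same]
    omega

lemma integralOperator_multilinear (hEven : ∀ i, Even (td i)) (hδ : Odd δ)
    {m : PS V (Fin n) td 1} (hm : MultilinearSeries k m)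
    (ts : List (((Fin n → ℕ) → k) × Fin n × List (Fin n)))
    {g : PS V (Fin (n + 1)) (tdx td δ) 1} (hg : MultilinearSeries k g) :
    MultilinearSeries k (integralOperator m ts g) := by
  intro α
  rw [untypedSeries_integralOperator]
  split_ifs
  · exact hm _
  · exact Submodule.smul_mem _ _ (hg.deltaEval k (even_tdx hEven hδ) _ _ _)

/-- Setting `t₀ = 0` is compatible with composition products. -/
lemma pcomp_cons_zero (hEven : ∀ i, Even (td i)) (hδ : Odd δ) {m : PS V (Fin n) td 1}
    {g : PS V (Fin (n + 1)) (tdx td δ) 1} (hg : ∀ α, g (Fin.cons 0 α) = recast V (m α))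
    (α : Fin n → ℕ) :
    untypedSeries k (pcomp k V (Fin (n + 1)) (tdx td δ) g g) (Fin.cons 0 α) =
      untypedSeries k (pcomp k V (Fin n) td m m) α := by
  rw [untypedSeries_pcomp k (even_tdx hEven hδ) odd_one, untypedSeries_pcomp k hEven odd_one]
  have hle {β : MI (Fin (n + 1))} (hβ : β ≤ Fin.cons 0 α) : β 0 = 0 := by
    simpa using hβ 0
  refine Finset.sum_nbij' (fun β i => β i.succ) (fun β => Fin.cons 0 β) ?_ ?_ ?_ ?_ ?_
  · intro β hβ
    rw [mem_below] at hβ ⊢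
    exact fun i => by simpa using hβ i.succ
  · intro β hβ
    rw [mem_below] at hβ ⊢
    exact Fin.cons_le_cons.mpr ⟨le_rfl, hβ⟩
  · intro β hβ
    exact cons_zero_tail (hle (mem_below.mp hβ))
  · intro β _
    simp
  · intro β hβ
    have hβ' := cons_zero_tail (hle (mem_below.mp hβ))
    have hsub : (Fin.cons 0 α - β : MI (Fin (n + 1))) =
        Fin.cons 0 (α - fun i => β i.succ) := by
      funext i
      refine Fin.cases ?_ (fun j => ?_) i <;> simp
    rw [hsub]
    conv_lhs => rw [← hβ']
    simp only [untypedSeries]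
    rw [hg, hg, untyped_recast k (by rw [degM_tdx_cons]),
      tagged_recast (by rw [degM_tdx_cons])]
    rfl

/-- An inner deformation of a family of `A∞`-structures is a family of `A∞`-structures. -/
theorem pcomp_self_eq_zero [CharZero k] (hEven : ∀ i, Even (td i)) (hδ : Odd δ)
    {m : PS V (Fin n) td 1} (hMC : pcomp k V (Fin n) td m m = 0)
    {ts : List (((Fin n → ℕ) → k) × Fin n × List (Fin n))}
    {g : PS V (Fin (n + 1)) (tdx td δ) 1} (hg : MultilinearSeries k g)
    (hsol : IsSol k V td δ m ts g) : pcomp k V (Fin (n + 1)) (tdx td δ) g g = 0 := by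
  have htd := even_tdx hEven hδ
  have key (N : ℕ) : ∀ α : MI (Fin (n + 1)), α 0 ≤ N →
      untypedSeries k (pcomp k V (Fin (n + 1)) (tdx td δ) g g) α = 0 := by
    have hzero (α : MI (Fin (n + 1))) (h : α 0 = 0) :
        untypedSeries k (pcomp k V (Fin (n + 1)) (tdx td δ) g g) α = 0 := by
      rw [← cons_zero_tail h, pcomp_cons_zero hEven hδ hsol.1, hMC, untypedSeries_zero]; rfl
    induction N with
    | zero => exact fun α h => hzero α (Nat.le_zero.mp h)
    | succ N ih =>
      intro α h
      by_cases h0 : α 0 = 0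
      · exact hzero α h0
      have hα : α - Pi.single 0 1 + Pi.single 0 1 = α :=
        tsub_add_cancel_of_le (single_one_le ‹_›)
      have hmem : (α - Pi.single 0 1 : MI (Fin (n + 1))) 0 ≤ N := by
        simp only [Pi.sub_apply, Pi.single_eq_same]; omega
      have hbr := seriesBracket_pderiv k htd hg 0 (α - Pi.single 0 1)
      rw [hα, hsol.2, untypedSeries_precast k (by simp [tdx]),
        seriesBracket_deltaEval k htd hg (S := {α | α 0 ≤ N})
          (fun α β hβ hα => (hβ 0).trans hα)
          (fun i hi α hα => by rwa [Set.mem_ofPred_eq, add_single_succ_zero hi])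
          ih δ liftTerm_index_mem _ hmem] at hbr
      exact (smul_eq_zero.mp hbr.symm).resolve_left (Nat.cast_ne_zero.mpr (Nat.succ_ne_zero _))
  refine untypedSeries_injective k ?_
  rw [untypedSeries_zero]
  exact funext fun α => key (α 0) α le_rfl

end Solution


/-- **inner deformations.** Let `m` be a formal `n`-parameter family of
`A∞`-structures on `V` with parameters of even degrees, and let `Δ` be a cup polynomial
in the partial derivatives `m₍ᵢ₎` (with homogeneous coefficients, of fixed odd total
degree `δ`). Introducing a new formal variable `t₀` of degree `1 − δ`, the differential
equation `∂g/∂t₀ = Δ[g]` with initial condition `g|_{t₀=0} = m` has a unique formal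
solution `g ∈ W[[t₀,t₁,…,tₙ]]`; the solution is homogeneous of degree 1 (encoded in its
type) and satisfies `g∘g = 0`, i.e. it is an `(n+1)`-parameter family of
`A∞`-structures deforming `m`. -/
theorem inner_deformation_exists_unique {n : ℕ} (td : Fin n → ℤ)
    (hEven : ∀ i, Even (td i)) (δ : ℤ) (hδ : Odd δ)
    (m : PS V (Fin n) td 1) (hmult : ∀ α, IsMultilinear k V (m α))
    (hMC : pcomp k V (Fin n) td m m = 0)
    (ts : List (((Fin n → ℕ) → k) × Fin n × List (Fin n)))
    (hcoef : CoeffHomog k V (Fin n) td m δ ts) :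
    ∃ g : PS V (Fin (n + 1)) (tdx td δ) 1,
      IsSol k V td δ m ts g ∧
      (∀ g' : PS V (Fin (n + 1)) (tdx td δ) 1, IsSol k V td δ m ts g' → g' = g) ∧
      pcomp k V (Fin (n + 1)) (tdx td δ) g g = 0 := by
  have hm : MultilinearSeries k m := fun α => (hmult α).untyped_mem
  obtain ⟨g, hfix, huniq, hg⟩ := exists_unique_fixedPoint (fun α : MI (Fin (n + 1)) => α 0)
    (integralOperator m ts) (integralOperator_congr m ts)
    (fun _ f => untyped k f ∈ multilinear k V (DirectSum ℤ V))
    (fun g hg => integralOperator_multilinear hEven hδ hm ts hg) 0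
    (fun α => by rw [Pi.zero_apply, map_zero]; exact Submodule.zero_mem _)
  have hsol := (isSol_iff_integralOperator m ts g).mpr hfix
  exact ⟨g, hsol, fun g' h => huniq g' ((isSol_iff_integralOperator m ts g').mp h),
    pcomp_self_eq_zero hEven hδ hMC hg hsol⟩

end Ainf
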